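/- arXiv:2301.13675 — 2 statements merged into one kernel-verified Lean document; each statement's English description precedes it below -/
import Mathlib

section
/- Let V be a valuation domain and M a V-module with pd M ≤ 1. Then there exists a V-module N with pd N ≤ 1 containing M as a submodule that is both pure in N and tight in N, such that N is a pure-injective object: every short exact sequence 0 → N → N' → C → 0 of V-modules in which the image of N is pure in N' and pd C ≤ 1 splits. -/
universe u v

open Pointwise

def PdLeOne (V : Type u) [CommRing V] (M : Type v) [AddCommGroup M] [Module V M] : Prop :=
  ∃ (P : Type (max u v)) (_ : AddCommGroup P) (_ : Module V P) (f : P →ₗ[V] M),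
    Module.Projective V P ∧ Function.Surjective f ∧ Module.Projective V (LinearMap.ker f)

def Tight (V : Type u) [CommRing V] {M : Type v} [AddCommGroup M] [Module V M]
    (N : Submodule V M) : Prop :=
  PdLeOne V (M ⧸ N)

/-- `B` tight in `A`, for submodules `B ≤ A` of an ambient module. -/
def TightIn (V : Type u) [CommRing V] {M : Type v} [AddCommGroup M] [Module V M]
    (B A : Submodule V M) : Prop :=
  Tight V (Submodule.comap A.subtype B)

/-- `N` is a pure submodule of `M`: `rN = N ∩ rM` for all `r`. -/
def IsPureSub (V : Type u) [CommRing V] {M : Type v} [AddCommGroup M] [Module V M]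
    (N : Submodule V M) : Prop :=
  ∀ r : V, r • N = N ⊓ r • (⊤ : Submodule V M)

universe w

section
open CategoryTheory Limits

namespace ModuleCat
attribute [local instance] Cardinal.fact_isRegular_aleph0

/-- The morphism from the ground ring determined by the image of `1`. -/
noncomputable def homOfElement {V : Type u} [CommRing V] {X : ModuleCat.{max u v} V} (m : X) :
    ModuleCat.of V (ULift.{v} V) ⟶ X :=
  ModuleCat.ofHom ((LinearMap.toSpanSingleton V X m).comp ULift.moduleEquiv.toLinearMap)

lemma homOfElement_one {V : Type u} [CommRing V] {X : ModuleCat.{max u v} V} (m : X) :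
    (homOfElement.{u, v} m).hom ⟨1⟩ = m := by
  simp [homOfElement]

lemma homOfElement_injective {V : Type u} [CommRing V] {X : ModuleCat.{max u v} V}
    {f g : ModuleCat.of V (ULift.{v} V) ⟶ X} (h : f.hom ⟨1⟩ = g.hom ⟨1⟩) : f = g := by
  ext ⟨x⟩
  have hx : (⟨x⟩ : ULift.{v} V) = x • ⟨1⟩ := by ext; simp
  erw [hx, map_smul, map_smul, h]

/-- Evaluation at `1` identifies the functor represented by the ground ring with `forget`. -/
noncomputable def coyonedaRingIso (V : Type u) [CommRing V] :
    forget (ModuleCat.{max u v} V) ≅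
      coyoneda.obj (Opposite.op (ModuleCat.of V (ULift.{v} V))) :=
  NatIso.ofComponents (fun X => Equiv.toIso
    { toFun := fun m => homOfElement.{u, v} m
      invFun := fun f => f.hom ⟨1⟩
      left_inv := fun m => homOfElement_one.{u, v} m
      right_inv := fun f => homOfElement_injective.{u, v} (homOfElement_one.{u, v} _) })
    (fun {X Y} f => by
      ext m
      refine homOfElement_injective.{u, v} ((homOfElement_one.{u, v} _).trans ?_)
      exact congr(f $(homOfElement_one.{u, v} m)).symm)

instance isCardinalAccessible_forget (V : Type u) [CommRing V] :
    (forget (ModuleCat.{max u v} V)).IsCardinalAccessible Cardinal.aleph0.{max u v} where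
  preservesColimitOfShape J _ _ := by
    have := isFiltered_of_isCardinalFiltered J Cardinal.aleph0.{max u v}
    have h : PreservesColimitsOfShape J
      (forget₂ (ModuleCat.{max u v} V) AddCommGrpCat.{max u v} ⋙
        forget AddCommGrpCat.{max u v}) := inferInstance
    exact h

instance isLocallyPresentable (V : Type u) [CommRing V] :
    IsLocallyPresentable.{max u v} (ModuleCat.{max u v} V) where
  exists_cardinal := by
    refine ⟨_, Cardinal.fact_isRegular_aleph0, ?_⟩
    rw [IsCardinalLocallyPresentable.iff_exists_isStrongGenerator]
    refine ⟨.singleton (ModuleCat.of V (ULift.{v} V)), inferInstance, ?_, ?_⟩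
    · rw [ObjectProperty.isStrongGenerator_iff]
      constructor
      · intro X Y f g h
        ext m
        have := h _ (by rw [ObjectProperty.singleton_iff]) (homOfElement.{u, v} m)
        have := congr(($this).hom ⟨1⟩)
        exact (congrArg f.hom (homOfElement_one.{u, v} m)).symm.trans
          (this.trans (congrArg g.hom (homOfElement_one.{u, v} m)))
      · intro X Y i _ hi
        rw [ConcreteCategory.isIso_iff_bijective]
        refine ⟨(ModuleCat.mono_iff_injective i).1 inferInstance, fun y => ?_⟩
        obtain ⟨f, hf⟩ := hi _ (by rw [ObjectProperty.singleton_iff]) (homOfElement.{u, v} y)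
        refine ⟨f.hom ⟨1⟩, ?_⟩
        exact congr(($hf).hom ⟨1⟩).trans (homOfElement_one.{u, v} y)
    · simp only [ObjectProperty.singleton_le_iff, CategoryTheory.isCardinalPresentable_iff]
      exact Functor.isCardinalAccessible_of_natIso (coyonedaRingIso V) _

end ModuleCat

lemma exists_hasSmallObjectArgument {V : Type u} [CommRing V] {ι : Type (max u v)}
    {A B : ι → ModuleCat.{max u v} V} (i : ∀ k, A k ⟶ B k) :
    MorphismProperty.HasSmallObjectArgument.{max u v} (MorphismProperty.ofHoms i) := by
  have hp (k : ι) : IsPresentable.{max u v} (A k) := inferInstance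
  choose κ hκ h using fun k => (hp k).exists_cardinal
  obtain ⟨μ, hμ, hle⟩ := HasCardinalLT.exists_regular_cardinal_forall.{max u v}
    (fun k => (κ k).ord.ToType)
  have : Fact μ.IsRegular := ⟨hμ⟩
  have : Nonempty μ.ord.ToType := by simpa using hμ.ne_zero
  have := WellFoundedLT.toOrderBot μ.ord.ToType
  refine ⟨μ, inferInstance, inferInstance, {
    isSmall := MorphismProperty.isSmall_ofHoms ..
    preservesColimit {X Y Z W} f hf g hg := ?_ }⟩
  obtain ⟨k⟩ := hf
  have := h k
  have hk : κ k ≤ μ := by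
    have := hle k
    simp [hasCardinalLT_iff_cardinal_mk_lt] at this
    exact this.le
  have : IsCardinalPresentable (A k) μ := isCardinalPresentable_of_le _ hk
  have := preservesColimitsOfShape_of_isCardinalPresentable (A k) μ μ.ord.ToType
  infer_instance

theorem exists_relative_cell_extension {V : Type u} [CommRing V] {ι : Type (max u v)}
    {A B : ι → Type (max u v)} [∀ k, AddCommGroup (A k)] [∀ k, Module V (A k)]
    [∀ k, AddCommGroup (B k)] [∀ k, Module V (B k)] (i : ∀ k, A k →ₗ[V] B k)
    (M : Type (max u v)) [AddCommGroup M] [Module V M] :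
    ∃ (N : Type (max u v)) (_ : AddCommGroup N) (_ : Module V N) (j : M →ₗ[V] N),
      (∀ k (f : A k →ₗ[V] N), ∃ g : B k →ₗ[V] N, g ∘ₗ i k = f) ∧
      ∀ (X Y : Type (max u v)) [AddCommGroup X] [AddCommGroup Y] [Module V X] [Module V Y]
        (p : X →ₗ[V] Y),
        (∀ k (f : A k →ₗ[V] X) (g : B k →ₗ[V] Y), p ∘ₗ f = g ∘ₗ i k →
          ∃ h : B k →ₗ[V] X, h ∘ₗ i k = f ∧ p ∘ₗ h = g) →
        ∀ (f : M →ₗ[V] X) (g : N →ₗ[V] Y), p ∘ₗ f = g ∘ₗ j →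
          ∃ h : N →ₗ[V] X, h ∘ₗ j = f ∧ p ∘ₗ h = g := by
  let I : MorphismProperty (ModuleCat.{max u v} V) :=
    MorphismProperty.ofHoms fun k => ModuleCat.ofHom (i k)
  have : MorphismProperty.HasSmallObjectArgument.{max u v} I :=
    exists_hasSmallObjectArgument.{u, v} _
  let d := MorphismProperty.factorizationData I.rlp.llp I.rlp
    (0 : ModuleCat.of V M ⟶ ModuleCat.of V PUnit)
  refine ⟨d.Z, inferInstance, inferInstance, d.i.hom, fun k f => ?_,
    fun X Y _ _ _ _ p hp f g hfg => ?_⟩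
  · have := d.hp _ (MorphismProperty.ofHoms.mk k)
    have sq : CommSq (ModuleCat.ofHom f) (ModuleCat.ofHom (i k)) d.p 0 := ⟨by ext⟩
    exact ⟨sq.lift.hom, congr(($sq.fac_left).hom)⟩
  · have hp' : I.rlp (ModuleCat.ofHom p) := by
      rintro _ _ _ ⟨k⟩
      refine ⟨fun {f g} sq => ⟨⟨?_⟩⟩⟩
      have h := hp k f.hom g.hom congr(($sq.w).hom)
      exact ⟨ModuleCat.ofHom h.choose, by ext1; exact h.choose_spec.1,
        by ext1; exact h.choose_spec.2⟩
    have := d.hi _ hp'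
    have sq : CommSq (ModuleCat.ofHom f) d.i (ModuleCat.ofHom p) (ModuleCat.ofHom g) :=
      ⟨by ext1; exact hfg⟩
    exact ⟨sq.lift.hom, congr(($sq.fac_left).hom), congr(($sq.fac_right).hom)⟩
end

section
variable {V : Type*} [CommRing V]

lemma LinearMap.exists_comp_eq_of_ker_le {X Y Z : Type*} [AddCommGroup X] [Module V X]
    [AddCommGroup Y] [Module V Y] [AddCommGroup Z] [Module V Z] (φ : X →ₗ[V] Y) (ψ : X →ₗ[V] Z)
    (hφ : Function.Surjective φ) (h : LinearMap.ker φ ≤ LinearMap.ker ψ) :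
    ∃ ℓ : Y →ₗ[V] Z, ℓ ∘ₗ φ = ψ := by
  refine ⟨(Submodule.liftQ _ ψ h) ∘ₗ (φ.quotKerEquivOfSurjective hφ).symm.toLinearMap, ?_⟩
  ext x
  have : (φ.quotKerEquivOfSurjective hφ).symm (φ x) = Submodule.Quotient.mk x := by
    rw [LinearEquiv.symm_apply_eq]; rfl
  simp [this]

lemma LinearMap.exists_comp_eq_of_range_le {X Y Z : Type*} [AddCommGroup X] [Module V X]
    [AddCommGroup Y] [Module V Y] [AddCommGroup Z] [Module V Z] [Module.Projective V X]
    (ψ : X →ₗ[V] Z) (q : Y →ₗ[V] Z) (h : LinearMap.range ψ ≤ LinearMap.range q) :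
    ∃ ℓ : X →ₗ[V] Y, q ∘ₗ ℓ = ψ := by
  obtain ⟨ℓ, hℓ⟩ := Module.projective_lifting_property q.rangeRestrict
    (ψ.codRestrict (LinearMap.range q) fun x => h ⟨x, rfl⟩) q.surjective_rangeRestrict
  exact ⟨ℓ, by ext x; simpa using congr((($hℓ) x : Z))⟩

/-- A form of Schanuel's lemma. -/
lemma projective_ker_of_comp_eq {P P' C : Type*} [AddCommGroup P] [Module V P]
    [AddCommGroup P'] [Module V P'] [AddCommGroup C] [Module V C] [Module.Projective V P']
    (σ : P →ₗ[V] C) (σ' : P' →ₗ[V] C) (a : P →ₗ[V] P') (b : P' →ₗ[V] P)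
    (ha : σ' ∘ₗ a = σ) (hb : σ ∘ₗ b = σ') [Module.Projective V (LinearMap.ker σ)] :
    Module.Projective V (LinearMap.ker σ') := by
  have ha' (x) : σ' (a x) = σ x := congr($ha x)
  have hb' (x) : σ (b x) = σ' x := congr($hb x)
  let f : LinearMap.ker σ' →ₗ[V] LinearMap.ker σ × P' :=
    ((b ∘ₗ (LinearMap.ker σ').subtype).codRestrict (LinearMap.ker σ) fun x => by
      simp [hb']).prod (LinearMap.ker σ').subtype
  let g : LinearMap.ker σ × P' →ₗ[V] LinearMap.ker σ' :=
    (a ∘ₗ (LinearMap.ker σ).subtype ∘ₗ LinearMap.fst V _ _ +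
      (LinearMap.id - a ∘ₗ b) ∘ₗ LinearMap.snd V _ _).codRestrict (LinearMap.ker σ') fun x => by
        simp [ha', hb']
  refine Module.Projective.of_split f g (LinearMap.ext fun x => Subtype.ext ?_)
  change a (b x) + ((x : P') - a (b x)) = x
  simp
end

lemma exists_injective_embedding {V : Type u} [CommRing V] [Small.{w} V] (X : Type w)
    [AddCommGroup X] [Module V X] :
    ∃ (E : Type w) (_ : AddCommGroup E) (_ : Module V E) (ι : X →ₗ[V] E),
      Module.Injective V E ∧ Function.Injective ι := by
  obtain ⟨⟨E, hE, f, hf⟩⟩ := CategoryTheory.EnoughInjectives.presentation (ModuleCat.of V X)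
  exact ⟨E, inferInstance, inferInstance, f.hom,
    Module.injective_module_of_injective_object V E, (ModuleCat.mono_iff_injective f).1 hf⟩

/-- Left lifting against epimorphisms whose kernels are quotients of injective modules. -/
def HasInjectiveKernelLifting (V : Type u) [CommRing V] {A B : Type w} [AddCommGroup A]
    [Module V A] [AddCommGroup B] [Module V B] (i : A →ₗ[V] B) : Prop :=
  ∀ (X Y E : Type w) [AddCommGroup X] [Module V X] [AddCommGroup Y] [Module V Y]
    [AddCommGroup E] [Module V E] [Module.Injective V E] (p : X →ₗ[V] Y),
    Function.Surjective p → ∀ q : E →ₗ[V] X, LinearMap.range q = LinearMap.ker p →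
    ∀ (f : A →ₗ[V] X) (t : B →ₗ[V] Y), p ∘ₗ f = t ∘ₗ i →
      ∃ h : B →ₗ[V] X, h ∘ₗ i = f ∧ p ∘ₗ h = t

section
variable {V : Type u} [CommRing V]

lemma exists_lift_of_projective_ker {A B C P X Y E : Type w}
    [AddCommGroup A] [Module V A] [AddCommGroup B] [Module V B] [AddCommGroup C] [Module V C]
    [AddCommGroup P] [Module V P] [AddCommGroup X] [Module V X] [AddCommGroup Y] [Module V Y]
    [AddCommGroup E] [Module V E] [Module.Injective V E]
    (i : A →ₗ[V] B) (g : B →ₗ[V] C) (hi : Function.Injective i)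
    (hig : LinearMap.range i = LinearMap.ker g) (hg : Function.Surjective g)
    (σ : P →ₗ[V] C) (hσ : Function.Surjective σ) [Module.Projective V P]
    [Module.Projective V (LinearMap.ker σ)]
    (p : X →ₗ[V] Y) (hp : Function.Surjective p)
    (q : E →ₗ[V] X) (hq : LinearMap.range q = LinearMap.ker p)
    (f : A →ₗ[V] X) (t : B →ₗ[V] Y) (hft : p ∘ₗ f = t ∘ₗ i) :
    ∃ h : B →ₗ[V] X, h ∘ₗ i = f ∧ p ∘ₗ h = t := by
  obtain ⟨s, hs⟩ := Module.projective_lifting_property g σ hg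
  obtain ⟨a, ha⟩ := LinearMap.exists_comp_eq_of_range_le (s ∘ₗ (LinearMap.ker σ).subtype) i (by
    rintro _ ⟨x, rfl⟩
    rw [hig]
    simpa using congr($hs x))
  obtain ⟨w, hw⟩ := Module.projective_lifting_property p (t ∘ₗ s) hp
  obtain ⟨e, he⟩ := LinearMap.exists_comp_eq_of_range_le
    (w ∘ₗ (LinearMap.ker σ).subtype - f ∘ₗ a) q (by
      rintro _ ⟨x, rfl⟩
      rw [hq]
      have h₁ := congr($hw x)
      have h₂ := congr($hft (a x))
      have h₃ := congr(t ($ha x))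
      simp at h₁ h₂ h₃
      simp [h₁, h₂, h₃])
  obtain ⟨e', he'⟩ := Module.Injective.out (LinearMap.ker σ).subtype
    (LinearMap.ker σ).injective_subtype e
  obtain ⟨ℓ, hℓ⟩ := LinearMap.exists_comp_eq_of_ker_le (i.coprod s) (f.coprod (w - q ∘ₗ e'))
    (by
      intro b
      obtain ⟨x, hx⟩ := hσ (g b)
      have : b - s x ∈ LinearMap.range i := by
        rw [hig]
        simpa [sub_eq_zero, hx] using congr($hs x).symm
      obtain ⟨y, hy⟩ := this
      exact ⟨(y, x), by simp [hy]⟩)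
    (by
      rintro ⟨y, x⟩ hyx
      simp only [LinearMap.mem_ker, LinearMap.coprod_apply] at hyx ⊢
      have hx : x ∈ LinearMap.ker σ := by
        have h₁ : g (i y) = 0 := by
          have : i y ∈ LinearMap.ker g := hig ▸ ⟨y, rfl⟩
          exact this
        have := congr(g $hyx)
        simp only [map_add, h₁, zero_add, map_zero] at this
        exact (congr($hs x)).symm.trans this
      have h₁ : i (a ⟨x, hx⟩) = s x := congr($ha ⟨x, hx⟩)
      have h₂ : y = - a ⟨x, hx⟩ := hi (by rw [map_neg, h₁]; exact eq_neg_of_add_eq_zero_left hyx)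
      have h₃ : q (e ⟨x, hx⟩) = w x - f (a ⟨x, hx⟩) := congr($he ⟨x, hx⟩)
      have h₄ : e' x = e ⟨x, hx⟩ := he' ⟨x, hx⟩
      simp [h₂, h₄, h₃])
  have hℓ' (y x) : ℓ (i y + s x) = f y + (w x - q (e' x)) := congr($hℓ (y, x))
  refine ⟨ℓ, ?_, ?_⟩
  · ext y
    simpa using hℓ' y 0
  · ext b
    obtain ⟨x, hx⟩ := hσ (g b)
    have : b - s x ∈ LinearMap.range i := by
      rw [hig]
      simpa [sub_eq_zero, hx] using congr($hs x).symm
    obtain ⟨y, hy⟩ := this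
    obtain rfl : b = i y + s x := by simp [hy]
    have h₁ := congr($hw x)
    have h₂ := congr($hft y)
    have h₃ : p (q (e' x)) = 0 := by
      have : q (e' x) ∈ LinearMap.ker p := hq ▸ ⟨_, rfl⟩
      exact this
    simp at h₁ h₂
    simp [hℓ', h₁, h₂, h₃]

lemma projective_ker_of_lift [Small.{w} V] {A B C P : Type w}
    [AddCommGroup A] [Module V A] [AddCommGroup B] [Module V B] [AddCommGroup C] [Module V C]
    [AddCommGroup P] [Module V P]
    (i : A →ₗ[V] B) (g : B →ₗ[V] C) (hig : LinearMap.range i = LinearMap.ker g)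
    (hg : Function.Surjective g)
    (σ : P →ₗ[V] C) (hσ : Function.Surjective σ) [Module.Projective V P]
    (H : HasInjectiveKernelLifting V i) :
    Module.Projective V (LinearMap.ker σ) := by
  have key (E : Type w) [AddCommGroup E] [Module V E] [Module.Injective V E] (W : Submodule V E)
      (k : LinearMap.ker σ →ₗ[V] E ⧸ W) : ∃ e : LinearMap.ker σ →ₗ[V] E, W.mkQ ∘ₗ e = k := by
    let R : Submodule V (P × (E ⧸ W)) := LinearMap.range ((LinearMap.ker σ).subtype.prod (-k))
    let p : ((P × (E ⧸ W)) ⧸ R) →ₗ[V] C := R.liftQ (σ ∘ₗ LinearMap.fst V _ _) (by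
      rintro _ ⟨x, rfl⟩
      simp)
    let ι : (E ⧸ W) →ₗ[V] ((P × (E ⧸ W)) ⧸ R) := R.mkQ ∘ₗ LinearMap.inr V _ _
    have hι : Function.Injective ι := by
      rw [injective_iff_map_eq_zero]
      intro y hy
      obtain ⟨x, hx⟩ := (Submodule.Quotient.mk_eq_zero R).1 hy
      have h₁ : (x : P) = 0 := congrArg Prod.fst hx
      have h₂ : - k x = y := congrArg Prod.snd hx
      obtain rfl : x = 0 := Subtype.ext h₁
      simpa using h₂.symm
    have hιp : LinearMap.range ι = LinearMap.ker p := by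
      apply le_antisymm
      · rintro _ ⟨y, rfl⟩
        simp [ι, p]
      · intro z hz
        obtain ⟨⟨x, y⟩, rfl⟩ := R.mkQ_surjective z
        have hx : x ∈ LinearMap.ker σ := by simpa [p] using hz
        refine ⟨y + k ⟨x, hx⟩, ?_⟩
        refine (Submodule.Quotient.eq R).2 ⟨⟨-x, neg_mem hx⟩, ?_⟩
        have : (⟨-x, neg_mem hx⟩ : LinearMap.ker σ) = - ⟨x, hx⟩ := rfl
        simp [this]
    have hιW : LinearMap.range (ι ∘ₗ W.mkQ) = LinearMap.ker p := by
      rw [LinearMap.range_comp W.mkQ ι, W.range_mkQ, Submodule.map_top, hιp]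
    obtain ⟨h, hh₁, hh₂⟩ := H _ _ E p
      (fun c => by obtain ⟨x, rfl⟩ := hσ c; exact ⟨R.mkQ (x, 0), by simp [p]⟩)
      (ι ∘ₗ W.mkQ) hιW
      0 g (by
        ext x
        have : i x ∈ LinearMap.ker g := hig ▸ ⟨x, rfl⟩
        simpa using this.symm)
    obtain ⟨s, hs⟩ := LinearMap.exists_comp_eq_of_ker_le g h hg (by
      rw [← hig]
      rintro _ ⟨x, rfl⟩
      exact congr($hh₁ x))
    have hps (c) : p (s c) = c := by
      obtain ⟨b, rfl⟩ := hg c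
      exact (congr(p ($hs b))).trans congr($hh₂ b)
    obtain ⟨r, hr⟩ := LinearMap.exists_comp_eq_of_range_le
      (R.mkQ ∘ₗ LinearMap.inl V _ _ - s ∘ₗ σ) (ι ∘ₗ W.mkQ) (by
        rw [hιW]
        rintro _ ⟨x, rfl⟩
        simp [hps]
        simp [p])
    refine ⟨r ∘ₗ (LinearMap.ker σ).subtype, ?_⟩
    ext x
    apply hι
    refine (congr($hr x)).trans ?_
    have : σ x = 0 := x.2
    simp only [LinearMap.sub_apply, LinearMap.comp_apply, this, map_zero, sub_zero]
    refine (Submodule.Quotient.eq R).2 ⟨x, ?_⟩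
    simp
  refine Module.Projective.of_lifting_property.{w} fun {X Y} _ _ _ _ f g hf => ?_
  obtain ⟨E, _, _, m, _, hm⟩ := exists_injective_embedding (V := V) X
  obtain ⟨ℓ, hℓ⟩ := LinearMap.exists_comp_eq_of_ker_le f
    (((LinearMap.ker f).map m).mkQ ∘ₗ m) hf fun x hx =>
      (Submodule.Quotient.mk_eq_zero _).2 ⟨x, hx, rfl⟩
  obtain ⟨e, he⟩ := key E ((LinearMap.ker f).map m) (ℓ ∘ₗ g)
  have hx (z) : ∃ x, m x = e z ∧ f x = g z := by
    obtain ⟨x, hx⟩ := hf (g z)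
    have h₁ : Submodule.Quotient.mk (e z) = ℓ (g z) := congr($he z)
    have h₂ : ℓ (f x) = Submodule.Quotient.mk (m x) := congr($hℓ x)
    rw [← hx, h₂, Submodule.Quotient.eq] at h₁
    obtain ⟨y, hy, hy'⟩ := h₁
    refine ⟨x + y, by rw [map_add, hy']; abel,
      by rw [map_add, hx, LinearMap.mem_ker.1 hy, add_zero]⟩
  obtain ⟨e', he'⟩ : ∃ e', m ∘ₗ e' = e := by
    refine ⟨(LinearEquiv.ofInjective m hm).symm.toLinearMap ∘ₗ
      e.codRestrict (LinearMap.range m) fun z => ?_, ?_⟩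
    · obtain ⟨x, hx, -⟩ := hx z
      exact ⟨x, hx⟩
    · ext z
      have := (LinearEquiv.ofInjective m hm).apply_symm_apply
        (e.codRestrict (LinearMap.range m) (fun z => (hx z).imp fun _ h => h.1) z)
      exact congrArg Subtype.val this
  refine ⟨e', LinearMap.ext fun z => ?_⟩
  obtain ⟨x, h₁, h₂⟩ := hx z
  have h₃ : m (e' z) = e z := congr($he' z)
  obtain rfl : x = e' z := hm (h₁.trans h₃.symm)
  exact h₂
end

section

lemma Cardinal.exists_range_eq {T C : Type w} {S : Set C} (hS : S.Nonempty)
    (h : Cardinal.mk S ≤ Cardinal.mk T) : ∃ t : T → C, Set.range t = S := by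
  have := hS.to_subtype
  obtain ⟨f⟩ := h
  refine ⟨Subtype.val ∘ Function.invFun f, ?_⟩
  rw [Set.range_comp, (Function.invFun_surjective f.injective).range_eq, Set.image_univ,
    Subtype.range_coe]

lemma Cardinal.mk_iUnion_le_of_forall_le {T C ι : Type w} [Infinite T] (f : ι → Set C)
    (hι : Cardinal.mk ι ≤ Cardinal.mk T) (hf : ∀ i, Cardinal.mk (f i) ≤ Cardinal.mk T) :
    Cardinal.mk (⋃ i, f i) ≤ Cardinal.mk T :=
  (Cardinal.mk_iUnion_le f).trans <|
    (mul_le_mul' hι (ciSup_le' hf)).trans (Cardinal.mul_eq_self (Cardinal.aleph0_le_mk T)).le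

/-- Closing a set of cardinality at most `#T` under finitary set-valued operations with
parameters in `V` does not increase its cardinality beyond `#T`. -/
lemma exists_closed_range {V : Type u} [Semiring V] {T C : Type w} [Infinite T]
    (e : T → V × (T →₀ V)) (he : Function.Surjective e) (φ : V → (C →₀ V) → Finset C)
    (t₀ : T → C) :
    ∃ t : T → C, Set.range t₀ ⊆ Set.range t ∧
      ∀ r, ∀ v ∈ Finsupp.supported V V (Set.range t), ↑(φ r v) ⊆ Set.range t := by
  have step (t : T → C) : ∃ t' : T → C, Set.range t ⊆ Set.range t' ∧
      ∀ r, ∀ v ∈ Finsupp.supported V V (Set.range t), ↑(φ r v) ⊆ Set.range t' := by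
    let S : Set C := Set.range t ∪ ⋃ x : T, (φ (e x).1 (Finsupp.mapDomain t (e x).2) : Set C)
    obtain ⟨t', ht'⟩ := Cardinal.exists_range_eq (T := T) (S := S) (Set.range_nonempty t).inl (by
      refine (Cardinal.mk_union_le _ _).trans (Cardinal.add_le_of_le (Cardinal.aleph0_le_mk T)
        Cardinal.mk_range_le (Cardinal.mk_iUnion_le_of_forall_le _ le_rfl fun x => ?_))
      exact (Cardinal.lt_aleph0_of_finite _).le.trans (Cardinal.aleph0_le_mk T))
    refine ⟨t', by rw [ht']; exact Set.subset_union_left, fun r v hv => ?_⟩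
    rw [← Set.image_univ, ← Finsupp.lmapDomain_supported] at hv
    obtain ⟨u, -, rfl⟩ := hv
    obtain ⟨x, hx⟩ := he (r, u)
    rw [ht']
    refine Set.subset_union_of_subset_right ?_ _
    refine Set.subset_iUnion_of_subset x ?_
    rw [hx]
    rfl
  choose s hs hs' using step
  let t (n : ℕ) : T → C := s^[n] t₀
  have ht (n) : t (n + 1) = s (t n) := Function.iterate_succ_apply' s n t₀
  have hmono : Monotone fun n => Set.range (t n) :=
    monotone_nat_of_le_succ fun n => by rw [ht]; exact hs _
  obtain ⟨t', ht'⟩ := Cardinal.exists_range_eq (T := T)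
    (S := ⋃ n : ULift.{w} ℕ, Set.range (t n.down))
    ((Set.range_nonempty t₀).mono
      (Set.subset_iUnion (fun n : ULift.{w} ℕ => Set.range (t n.down)) ⟨0⟩))
    (Cardinal.mk_iUnion_le_of_forall_le _ (by simp)
      fun _ => Cardinal.mk_range_le)
  have ht'' : Set.range t' = ⋃ n, Set.range (t n) :=
    ht'.trans (Equiv.ulift.surjective.iUnion_comp fun n => Set.range (t n))
  refine ⟨t', by rw [ht'']; exact Set.subset_iUnion (fun n => Set.range (t n)) 0, fun r v hv => ?_⟩
  rw [ht''] at hv ⊢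
  obtain ⟨n, hn⟩ := (hmono.directed_le).exists_mem_subset_of_finset_subset_biUnion
    (s := v.support) ((Finsupp.mem_supported _ _).1 hv)
  refine Set.subset_iUnion_of_subset (n + 1) ?_
  rw [ht]
  exact hs' _ _ _ ((Finsupp.mem_supported _ _).2 hn)
end

section
variable (V : Type*) [CommRing V] (Q : Type*) [AddCommGroup Q] [Module V Q]

/-- Pairs of a scalar and an element it annihilates. -/
abbrev AnnihilatedPair : Type _ := {x : V × Q // x.1 • x.2 = 0}

/-- The relations presenting the direct sum of the cyclic modules `V ⧸ (r)` indexed by the pairs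
`(r, c)` with `r • c = 0`. -/
noncomputable abbrev PureCover.relations : Submodule V (AnnihilatedPair V Q →₀ V) :=
  Submodule.span V (Set.range fun x : AnnihilatedPair V Q => Finsupp.single x x.1.1)

/-- The direct sum of the cyclic modules `V ⧸ (r)` indexed by the pairs `(r, c)` with
`r • c = 0`. -/
def PureCover : Type _ := (AnnihilatedPair V Q →₀ V) ⧸ PureCover.relations V Q

namespace PureCover
noncomputable instance : AddCommGroup (PureCover V Q) :=
  inferInstanceAs (AddCommGroup ((AnnihilatedPair V Q →₀ V) ⧸ relations V Q))

noncomputable instance : Module V (PureCover V Q) :=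
  inferInstanceAs (Module V ((AnnihilatedPair V Q →₀ V) ⧸ relations V Q))

/-- The quotient map defining the pure cover. -/
noncomputable def mk : (AnnihilatedPair V Q →₀ V) →ₗ[V] PureCover V Q := (relations V Q).mkQ

variable {V Q}

/-- The generator of a cyclic summand of `PureCover V Q`. -/
noncomputable def gen (x : AnnihilatedPair V Q) : PureCover V Q := mk V Q (Finsupp.single x 1)

lemma smul_gen (x : AnnihilatedPair V Q) : x.1.1 • gen x = 0 := by
  rw [gen, ← map_smul, Finsupp.smul_single, smul_eq_mul, mul_one]
  exact (Submodule.Quotient.mk_eq_zero _).2 (Submodule.subset_span ⟨x, rfl⟩)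

/-- The linear map determined by the images of the generators. -/
noncomputable def lift {B : Type*} [AddCommGroup B] [Module V B] (f : AnnihilatedPair V Q → B)
    (hf : ∀ x, x.1.1 • f x = 0) : PureCover V Q →ₗ[V] B :=
  (relations V Q).liftQ (Finsupp.linearCombination V f) <| by
    rw [Submodule.span_le]
    rintro _ ⟨x, rfl⟩
    simp [hf]

@[simp]
lemma lift_gen {B : Type*} [AddCommGroup B] [Module V B] (f : AnnihilatedPair V Q → B)
    (hf : ∀ x, x.1.1 • f x = 0) (x : AnnihilatedPair V Q) : lift f hf (gen x) = f x := by
  change Finsupp.linearCombination V f (Finsupp.single x 1) = f x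
  simp

lemma hom_ext {B : Type*} [AddCommGroup B] [Module V B] {f g : PureCover V Q →ₗ[V] B}
    (h : ∀ x, f (gen x) = g (gen x)) : f = g := by
  have H : f ∘ₗ mk V Q = g ∘ₗ mk V Q := by
    ext x
    exact h x
  ext p
  obtain ⟨v, rfl⟩ := (relations V Q).mkQ_surjective p
  exact congr($H v)

variable (V Q) in
/-- The canonical projection of the pure cover. -/
noncomputable def proj : PureCover V Q →ₗ[V] Q := lift (fun x => x.1.2) fun x => x.2

lemma exists_proj_eq_of_smul_eq_zero {r : V} {c : Q} (h : r • c = 0) :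
    ∃ p, proj V Q p = c ∧ r • p = 0 :=
  ⟨gen ⟨(r, c), h⟩, by simp [proj], smul_gen _⟩

lemma proj_surjective : Function.Surjective (proj V Q) := fun c =>
  (exists_proj_eq_of_smul_eq_zero (zero_smul V c)).imp fun _ h => h.1

lemma exists_smul_eq_of_smul_mem_ker_proj {r : V} {p : PureCover V Q}
    (h : r • p ∈ LinearMap.ker (proj V Q)) :
    ∃ p' ∈ LinearMap.ker (proj V Q), r • p' = r • p := by
  obtain ⟨e, he, hre⟩ := exists_proj_eq_of_smul_eq_zero (V := V) (c := proj V Q p) (r := r)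
    (by simpa using h)
  exact ⟨p - e, by simp [he], by simp [smul_sub, hre]⟩

/-- The pure cover is projective relative to pure epimorphisms. -/
lemma exists_lift {B C : Type*} [AddCommGroup B] [Module V B] [AddCommGroup C] [Module V C]
    (G : B →ₗ[V] C) (hG : Function.Surjective G)
    (hpure : ∀ (r : V) (b : B), r • b ∈ LinearMap.ker G → ∃ a ∈ LinearMap.ker G, r • a = r • b)
    (φ : Q →ₗ[V] C) : ∃ s : PureCover V Q →ₗ[V] B, G ∘ₗ s = φ ∘ₗ proj V Q := by
  have H (x : AnnihilatedPair V Q) : ∃ b, G b = φ x.1.2 ∧ x.1.1 • b = 0 := by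
    obtain ⟨b, hb⟩ := hG (φ x.1.2)
    obtain ⟨a, ha, hab⟩ := hpure x.1.1 b (by
      rw [LinearMap.mem_ker, map_smul, hb, ← map_smul, x.2, map_zero])
    exact ⟨b - a, by rw [map_sub, hb, LinearMap.mem_ker.1 ha, sub_zero],
      by rw [smul_sub, hab, sub_self]⟩
  choose b hb hb' using H
  exact ⟨lift b hb', hom_ext fun x => by simp [hb, proj]⟩

end PureCover

lemma exists_linearPMap_le_domain_eq_comap_range {V B C F N : Type*} [CommRing V]
    [AddCommGroup B] [Module V B] [AddCommGroup C] [Module V C] [AddCommGroup F] [Module V F]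
    [AddCommGroup N] [Module V N] (G : B →ₗ[V] C) (hG : Function.Surjective G)
    (hpure : ∀ (r : V) (b : B), r • b ∈ LinearMap.ker G → ∃ a ∈ LinearMap.ker G, r • a = r • b)
    (τ : F →ₗ[V] C)
    (hext : ∀ f : LinearMap.ker (PureCover.proj V (F ⧸ LinearMap.ker τ)) →ₗ[V] N,
      ∃ g : PureCover V (F ⧸ LinearMap.ker τ) →ₗ[V] N, g ∘ₗ Submodule.subtype _ = f)
    (h : B →ₗ.[V] N) (hdom : h.domain = LinearMap.ker G) :
    ∃ h' : B →ₗ.[V] N, h ≤ h' ∧ h'.domain = (LinearMap.range τ).comap G := by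
  let τ' := (LinearMap.ker τ).liftQ τ le_rfl
  obtain ⟨s, hs⟩ := PureCover.exists_lift G hG hpure τ'
  have hs' (p) : G (s p) = τ' (PureCover.proj V _ p) := congr($hs p)
  have hτ' : LinearMap.ker τ' = ⊥ := Submodule.ker_liftQ_eq_bot _ _ _ le_rfl
  obtain ⟨w, hw⟩ := hext (h.toFun ∘ₗ
    (s ∘ₗ Submodule.subtype _).codRestrict h.domain fun p => by simp [hdom, hs'])
  have hw' (p) (hp : PureCover.proj V _ p = 0) (hsp : s p ∈ h.domain) : w p = h ⟨s p, hsp⟩ :=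
    congr($hw ⟨p, hp⟩)
  have hle : h.domain ≤ (LinearMap.range τ).comap G := by
    rw [hdom]
    intro b hb
    simp [LinearMap.mem_ker.1 hb]
  have hsD (p) : s p ∈ (LinearMap.range τ).comap G := by
    obtain ⟨x, hx⟩ := Submodule.mkQ_surjective _ (PureCover.proj V _ p)
    exact ⟨x, by rw [hs', ← hx]; simp [τ']⟩
  obtain ⟨ℓ, hℓ⟩ := LinearMap.exists_comp_eq_of_ker_le
    ((Submodule.inclusion hle).coprod (s.codRestrict _ hsD)) (h.toFun.coprod w) (by
      rintro ⟨b, x, hx⟩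
      obtain ⟨p, hp⟩ := PureCover.proj_surjective (V := V) ((LinearMap.ker τ).mkQ x)
      have hb : b - s p ∈ h.domain := by
        simp [hdom, hs', hp, τ', hx]
      exact ⟨(⟨b - s p, hb⟩, p), Subtype.ext (by simp)⟩) (by
      rintro ⟨a, p⟩ hap
      have h₁ : (a : B) + s p = 0 := congrArg Subtype.val hap
      have ha : (a : B) ∈ LinearMap.ker G := hdom ▸ a.2
      have hp : PureCover.proj V _ p = 0 := by
        have : G (a + s p) = 0 := by rw [h₁, map_zero]
        rw [map_add, LinearMap.mem_ker.1 ha, hs', zero_add] at this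
        exact (LinearMap.ker_eq_bot'.1 hτ') _ this
      have h₂ : s p = -a := eq_neg_of_add_eq_zero_right h₁
      have h₃ : s p ∈ h.domain := h₂ ▸ neg_mem a.2
      have h₄ : (⟨s p, h₃⟩ : h.domain) = -a := Subtype.ext h₂
      change h a + w p = 0
      rw [hw' p hp h₃, h₄, h.map_neg, add_neg_cancel])
  refine ⟨⟨_, ℓ⟩, ⟨hle, ?_⟩, rfl⟩
  intro x y hxy
  have h₂ := congr($hℓ (x, 0))
  obtain rfl : Submodule.inclusion hle x = y := Subtype.ext hxy
  simpa using h₂.symm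
end

lemma projective_ker_comp_of_range_eq {V P F C : Type*} [CommRing V] [AddCommGroup P]
    [Module V P] [AddCommGroup F] [Module V F] [AddCommGroup C] [Module V C]
    [Module.Projective V P] (σ : F →ₗ[V] C) {t : P →ₗ[V] F} {S : Submodule V F}
    (ht : LinearMap.range t = S) [Module.Projective V S]
    [Module.Projective V (LinearMap.ker (σ ∘ₗ S.subtype))] :
    Module.Projective V (LinearMap.ker (σ ∘ₗ t)) := by
  obtain ⟨a, ha⟩ := LinearMap.exists_comp_eq_of_range_le S.subtype t
    (by rw [ht, Submodule.range_subtype])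
  refine projective_ker_of_comp_eq (σ ∘ₗ S.subtype) _ a
    (t.codRestrict S fun v => ht ▸ ⟨v, rfl⟩) ?_ rfl
  rw [← ha]
  rfl

lemma projective_ker_mkQ_comp_of_retract {V F F' C : Type*} [CommRing V] [AddCommGroup F]
    [Module V F] [AddCommGroup F'] [Module V F'] [AddCommGroup C] [Module V C]
    {σ : F →ₗ[V] C} (e : LinearMap.ker σ →ₗ[V] (LinearMap.ker σ →₀ V))
    (he : ∀ k, Finsupp.linearCombination V Subtype.val (e k) = k.1)
    {FY FZ : Submodule V F} (hYZ : FY ≤ FZ)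
    (hY : ∀ k : LinearMap.ker σ, (k : F) ∈ FY → ∀ k' ∈ (e k).support, (k' : F) ∈ FY)
    (hZ : ∀ k : LinearMap.ker σ, (k : F) ∈ FZ → ∀ k' ∈ (e k).support, (k' : F) ∈ FZ)
    (ρ : F →ₗ[V] F') (ι : F' →ₗ[V] F) (hρι : ∀ l, ρ (ι l) = l) (hρY : ∀ v ∈ FY, ρ v = 0)
    (hιZ : ∀ l, ι l ∈ FZ) (hρZ : ∀ v ∈ FZ, v - ι (ρ v) ∈ FY) :
    Module.Projective V (LinearMap.ker ((FY.map σ).mkQ ∘ₗ σ ∘ₗ ι)) := by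
  classical
  set τ := (FY.map σ).mkQ ∘ₗ σ ∘ₗ ι with hτ
  have hρker (k : LinearMap.ker σ) (hk : (k : F) ∈ FZ) : ρ k ∈ LinearMap.ker τ := by
    refine (Submodule.Quotient.mk_eq_zero _).2 ⟨-(k - ι (ρ k)), neg_mem (hρZ _ hk), ?_⟩
    simp
  let KZ : Submodule V (LinearMap.ker σ) := FZ.comap (Submodule.subtype _)
  let R : KZ →ₗ[V] LinearMap.ker τ :=
    (ρ ∘ₗ Submodule.subtype _ ∘ₗ KZ.subtype).codRestrict _ fun k => hρker k.1 k.2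
  let r : (LinearMap.ker σ →₀ V) →ₗ[V] LinearMap.ker τ :=
    Finsupp.linearCombination V fun k => if h : k ∈ KZ then R ⟨k, h⟩ else 0
  have hr (k : KZ) : r (e k) = R k := by
    refine Subtype.ext ?_
    have h₁ : (R k : F') = ρ k.1.1 := rfl
    rw [h₁, ← he k.1]
    simp only [r, Finsupp.linearCombination_apply, Finsupp.sum, map_sum, map_smul,
      Submodule.coe_sum, Submodule.coe_smul]
    refine Finset.sum_congr rfl fun k' hk' => ?_
    have hk'Z : k' ∈ KZ := hZ k.1 k.2 k' hk'
    rw [dif_pos hk'Z]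
    rfl
  let p : LinearMap.ker σ → Prop := fun k => (k : F) ∉ FY
  let s₀ : KZ →ₗ[V] (LinearMap.ker σ →₀ V) :=
    Finsupp.linearCombination V (fun k => if p k then Finsupp.single k 1 else 0) ∘ₗ e ∘ₗ KZ.subtype
  have hrs₀ : r ∘ₗ s₀ = R := by
    have : r ∘ₗ Finsupp.linearCombination V
        (fun k => if p k then Finsupp.single k 1 else 0) = r := by
      ext k : 2
      by_cases hk : p k
      · simp [hk]
      · have h₁ : R ⟨k, hYZ (not_not.1 hk)⟩ = 0 := Subtype.ext (hρY _ (not_not.1 hk))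
        have h₂ : r (Finsupp.single k 1) = 0 := by
          simp only [r, Finsupp.linearCombination_single, one_smul]
          split_ifs
          exacts [h₁, rfl]
        simp [hk, h₂]
    ext1 k
    exact congr($this (e k)).trans (hr k)
  have hR : Function.Surjective R := by
    rintro ⟨l, hl⟩
    obtain ⟨y, hy, hyl⟩ := (Submodule.Quotient.mk_eq_zero _).1 hl
    refine ⟨⟨⟨ι l - y, ?_⟩, sub_mem (hιZ l) (hYZ hy)⟩, Subtype.ext ?_⟩
    · rw [LinearMap.mem_ker, map_sub, hyl, LinearMap.comp_apply, sub_self]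
    · change ρ (ι l - y) = l
      rw [map_sub, hρY y hy, sub_zero, hρι]
  obtain ⟨s, hs⟩ := LinearMap.exists_comp_eq_of_ker_le R s₀ hR fun k hk => by
    have hρk : ρ k.1.1 = 0 := congrArg Subtype.val hk
    have hkY : (k.1.1 : F) ∈ FY := by
      simpa [hρk] using hρZ _ k.2
    change Finsupp.linearCombination V _ (e k.1) = 0
    rw [Finsupp.linearCombination_apply]
    refine Finset.sum_eq_zero fun k' hk' => ?_
    have : ¬ p k' := not_not.2 (hY k.1 hkY k' hk')
    simp [this]
  refine Module.Projective.of_split s r ?_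
  ext1 l
  obtain ⟨k, rfl⟩ := hR l
  exact congr(r ($hs k)).trans congr($hrs₀ k)

section
variable {V : Type*} [CommRing V] {X C : Type*} [AddCommGroup C] [Module V C]
  {σ : (X →₀ V) →ₗ[V] C} {e : LinearMap.ker σ →ₗ[V] (LinearMap.ker σ →₀ V)}

/-- A set `Y` of generators such that the presentation `σ`, whose kernel is a summand of a free
module via `e`, restricts to a presentation of a pure submodule by the generators in `Y` with a
complementary summand of relations. -/
structure IsAdaptedSet (σ : (X →₀ V) →ₗ[V] C)
    (e : LinearMap.ker σ →ₗ[V] (LinearMap.ker σ →₀ V)) (Y : Set X) : Prop where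
  mem_of_mem_support : ∀ k : LinearMap.ker σ, (k : X →₀ V) ∈ Finsupp.supported V V Y →
    ∀ k' ∈ (e k).support, (k' : X →₀ V) ∈ Finsupp.supported V V Y
  exists_smul_eq : ∀ (r : V) (c : C), r • c ∈ (Finsupp.supported V V Y).map σ →
    ∃ c' ∈ (Finsupp.supported V V Y).map σ, r • c' = r • c

namespace IsAdaptedSet

lemma empty : IsAdaptedSet σ e ∅ where
  mem_of_mem_support k hk k' hk' := by
    have : k = 0 := Subtype.ext (by simpa using hk)
    simp [this] at hk'
  exists_smul_eq r c hc := ⟨0, zero_mem _, by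
    rw [Finsupp.supported_empty, Submodule.map_bot, Submodule.mem_bot] at hc
    rw [hc, smul_zero]⟩

lemma exists_mem_supported_of_directedOn {c : Set (Set X)} (hne : c.Nonempty)
    (hc : DirectedOn (· ⊆ ·) c) {v : X →₀ V} (hv : v ∈ Finsupp.supported V V (⋃₀ c)) :
    ∃ Y ∈ c, v ∈ Finsupp.supported V V Y := by
  obtain ⟨Y, hY, h⟩ := hc.exists_mem_subset_of_finset_subset_biUnion hne
    (f := id) (s := v.support)
    (by simpa [Set.sUnion_eq_biUnion] using (Finsupp.mem_supported _ _).1 hv)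
  exact ⟨Y, hY, (Finsupp.mem_supported _ _).2 h⟩

lemma sUnion {c : Set (Set X)} (hne : c.Nonempty) (hc : DirectedOn (· ⊆ ·) c)
    (h : ∀ Y ∈ c, IsAdaptedSet σ e Y) : IsAdaptedSet σ e (⋃₀ c) where
  mem_of_mem_support k hk k' hk' := by
    obtain ⟨Y, hY, hkY⟩ := exists_mem_supported_of_directedOn hne hc hk
    exact Finsupp.supported_mono (Set.subset_sUnion_of_mem hY)
      ((h Y hY).mem_of_mem_support k hkY k' hk')
  exists_smul_eq r c' hc' := by
    obtain ⟨v, hv, hvc⟩ := hc'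
    obtain ⟨Y, hY, hvY⟩ := exists_mem_supported_of_directedOn hne hc hv
    obtain ⟨c'', h₁, h₂⟩ := (h Y hY).exists_smul_eq r c' ⟨v, hvY, hvc⟩
    exact ⟨c'', Submodule.map_mono (Finsupp.supported_mono (Set.subset_sUnion_of_mem hY)) h₁, h₂⟩

lemma projective_ker_mkQ_comp (he : ∀ k, Finsupp.linearCombination V Subtype.val (e k) = k.1)
    {Y Z : Set X} (hY : IsAdaptedSet σ e Y) (hZ : IsAdaptedSet σ e Z) (hYZ : Y ⊆ Z) :
    Module.Projective V (LinearMap.ker (((Finsupp.supported V V Y).map σ).mkQ ∘ₗ σ ∘ₗ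
      (Finsupp.supported V V (Z \ Y)).subtype)) := by
  classical
  have H := projective_ker_mkQ_comp_of_retract (F := X →₀ V)
    (F' := Finsupp.supported V V (Z \ Y)) (σ := σ) e he (FY := Finsupp.supported V V Y)
    (FZ := Finsupp.supported V V Z) (Finsupp.supported_mono hYZ)
  have H' := H hY.mem_of_mem_support hZ.mem_of_mem_support (Finsupp.restrictDom V V (Z \ Y))
    (Finsupp.supported V V (Z \ Y)).subtype
  refine H' (fun v => Subtype.ext ?_) (fun v hv => Subtype.ext ?_) (fun v => ?_) (fun v hv => ?_)
  · refine (Finsupp.filter_eq_self_iff _ _).2 fun x hx => ?_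
    exact (Finsupp.mem_supported _ _).1 v.2 (Finsupp.mem_support_iff.2 hx)
  · refine (Finsupp.filter_eq_zero_iff _ _).2 fun x hx => ?_
    by_contra hne
    exact hx.2 ((Finsupp.mem_supported _ _).1 hv (Finsupp.mem_support_iff.2 hne))
  · exact Finsupp.supported_mono Set.sdiff_subset v.2
  · rw [Finsupp.mem_supported']
    intro x hx
    change v x - Finsupp.filter (· ∈ Z \ Y) v x = 0
    by_cases hxZ : x ∈ Z
    · rw [Finsupp.filter_apply_pos _ _ ⟨hxZ, hx⟩, sub_self]
    · rw [Finsupp.filter_apply_neg _ _ (fun h => hxZ h.1),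
        (Finsupp.mem_supported' _ _).1 hv x hxZ, sub_zero]

lemma projective_ker_and_comap_range
    (he : ∀ k, Finsupp.linearCombination V Subtype.val (e k) = k.1)
    {Y Z : Set X} (hY : IsAdaptedSet σ e Y) (hZ : IsAdaptedSet σ e Z) (hYZ : Y ⊆ Z)
    {T : Type*} {t : T → X} (ht : Set.range t = Z \ Y) :
    Module.Projective V (LinearMap.ker (((Finsupp.supported V V Y).map σ).mkQ ∘ₗ σ ∘ₗ
      Finsupp.lmapDomain V V t)) ∧
    (LinearMap.range (((Finsupp.supported V V Y).map σ).mkQ ∘ₗ σ ∘ₗ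
      Finsupp.lmapDomain V V t)).comap ((Finsupp.supported V V Y).map σ).mkQ =
      (Finsupp.supported V V Z).map σ := by
  have hrange : LinearMap.range (Finsupp.lmapDomain V V t) = Finsupp.supported V V (Z \ Y) := by
    rw [Finsupp.range_lmapDomain, Finsupp.supported_eq_span_single, ← ht, ← Set.range_comp]
    rfl
  constructor
  · have := projective_ker_mkQ_comp he hY hZ hYZ
    have : Module.Projective V (Finsupp.supported V V (Z \ Y)) :=
      Module.Projective.of_equiv (Finsupp.supportedEquivFinsupp (Z \ Y)).symm
    exact projective_ker_comp_of_range_eq (F := X →₀ V)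
      (((Finsupp.supported V V Y).map σ).mkQ ∘ₗ σ) hrange
  · rw [LinearMap.range_comp, LinearMap.range_comp, hrange, Submodule.comap_map_mkQ,
      ← Submodule.map_sup, ← Finsupp.supported_union, Set.union_sdiff_cancel hYZ]

end IsAdaptedSet
end

lemma IsAdaptedSet.exists_union_range {V : Type u} [CommRing V] {X T : Type w} [Infinite T]
    {C : Type*} [AddCommGroup C] [Module V C] {σ : (X →₀ V) →ₗ[V] C}
    {e : LinearMap.ker σ →ₗ[V] (LinearMap.ker σ →₀ V)} (hσ : Function.Surjective σ)
    (enum : T → V × (T →₀ V)) (henum : Function.Surjective enum)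
    {Y : Set X} (hY : IsAdaptedSet σ e Y) (t₀ : T → X) :
    ∃ t : T → X, Set.range t₀ ⊆ Set.range t ∧ IsAdaptedSet σ e (Y ∪ Set.range t) := by
  classical
  let φ (r : V) (v : X →₀ V) : Finset X :=
    (if h : ∃ k : LinearMap.ker σ, k - v ∈ Finsupp.supported V V Y then
      (e h.choose).support.biUnion fun k' => k'.1.support else ∅) ∪
    (if h : ∃ w, ∃ y ∈ Finsupp.supported V V Y, r • σ w = σ (y + v) then
      h.choose.support else ∅)
  obtain ⟨t, ht₀, ht⟩ := exists_closed_range enum henum φ t₀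
  have hmonoY : Finsupp.supported V V Y ≤ Finsupp.supported V V (Y ∪ Set.range t) :=
    Finsupp.supported_mono Set.subset_union_left
  have hmonot : Finsupp.supported V V (Set.range t) ≤ Finsupp.supported V V (Y ∪ Set.range t) :=
    Finsupp.supported_mono Set.subset_union_right
  refine ⟨t, ht₀, ⟨fun k hk k' hk' => ?_, fun r c hc => ?_⟩⟩
  · rw [Finsupp.supported_union] at hk
    obtain ⟨y, hy, v, hv, hyv⟩ := Submodule.mem_sup.1 hk
    have h : ∃ k : LinearMap.ker σ, k - v ∈ Finsupp.supported V V Y :=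
      ⟨k, by rwa [← hyv, add_sub_cancel_right]⟩
    have hk₀ : ((k - h.choose : LinearMap.ker σ) : X →₀ V) ∈ Finsupp.supported V V Y := by
      have : ((k - h.choose : LinearMap.ker σ) : X →₀ V) = y - (h.choose - v) := by
        rw [Submodule.coe_sub, ← hyv]
        abel
      rw [this]
      exact sub_mem hy h.choose_spec
    have hmem : k' ∈ (e (k - h.choose)).support ∪ (e h.choose).support := by
      have hsum : e k = e (k - h.choose) + e h.choose :=
        (congrArg e (Subtype.ext (sub_add_cancel k.1 h.choose.1).symm)).trans (map_add e _ _)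
      exact Finsupp.support_add (hsum ▸ hk')
    rcases Finset.mem_union.1 hmem with h' | h'
    · exact hmonoY (hY.mem_of_mem_support _ hk₀ _ h')
    · refine hmonot ((Finsupp.mem_supported _ _).2 (subset_trans ?_ (ht 0 v hv)))
      rw [Finset.coe_subset]
      refine subset_trans ?_ Finset.subset_union_left
      rw [dif_pos h]
      exact Finset.subset_biUnion_of_mem (fun k' : LinearMap.ker σ => k'.1.support) h'
  · obtain ⟨z, hz, hzc⟩ := hc
    rw [Finsupp.supported_union] at hz
    obtain ⟨y, hy, v, hv, rfl⟩ := Submodule.mem_sup.1 hz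
    obtain ⟨w, rfl⟩ := hσ c
    have h : ∃ w, ∃ y ∈ Finsupp.supported V V Y, r • σ w = σ (y + v) := ⟨w, y, hy, hzc.symm⟩
    obtain ⟨y₀, hy₀, hw₀⟩ := h.choose_spec
    have hw : h.choose ∈ Finsupp.supported V V (Set.range t) := by
      refine (Finsupp.mem_supported _ _).2 (subset_trans ?_ (ht r v hv))
      rw [Finset.coe_subset]
      refine subset_trans ?_ Finset.subset_union_right
      rw [dif_pos h]
    obtain ⟨c', hc', hc''⟩ := hY.exists_smul_eq r (σ w - σ h.choose) ⟨y - y₀, sub_mem hy hy₀, by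
      rw [smul_sub, hw₀, ← hzc]
      simp⟩
    exact ⟨c' + σ h.choose, add_mem (Submodule.map_mono hmonoY hc') ⟨_, hmonot hw, rfl⟩, by
      rw [smul_add, hc'', smul_sub, sub_add_cancel]⟩

lemma IsAdaptedSet.exists_linearPMap_lt {V : Type u} [CommRing V] {X T : Type w} [Infinite T]
    {N B C : Type*} [AddCommGroup N] [Module V N] [AddCommGroup B] [Module V B]
    [AddCommGroup C] [Module V C] {σ : (X →₀ V) →ₗ[V] C}
    {e : LinearMap.ker σ →ₗ[V] (LinearMap.ker σ →₀ V)} (hσ : Function.Surjective σ)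
    (he : ∀ k, Finsupp.linearCombination V Subtype.val (e k) = k.1)
    (enum : T → V × (T →₀ V)) (henum : Function.Surjective enum)
    (hN : ∀ L : Submodule V (T →₀ V), Module.Projective V L →
      ∀ f : LinearMap.ker (PureCover.proj V ((T →₀ V) ⧸ L)) →ₗ[V] N,
        ∃ g : PureCover V ((T →₀ V) ⧸ L) →ₗ[V] N, g ∘ₗ Submodule.subtype _ = f)
    {g : B →ₗ[V] C} (hg : Function.Surjective g)
    (hpure : ∀ (r : V) (b : B), r • b ∈ LinearMap.ker g → ∃ a ∈ LinearMap.ker g, r • a = r • b)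
    {Y : Set X} (hY : IsAdaptedSet σ e Y) (h : B →ₗ.[V] N)
    (hdom : h.domain = ((Finsupp.supported V V Y).map σ).comap g) {x : X} (hx : x ∉ Y) :
    ∃ (Z : Set X) (h' : B →ₗ.[V] N), Y ⊆ Z ∧ x ∈ Z ∧ h ≤ h' ∧ IsAdaptedSet σ e Z ∧
      h'.domain = ((Finsupp.supported V V Z).map σ).comap g := by
  obtain ⟨t, ht₀, hZ⟩ := hY.exists_union_range hσ enum henum fun _ => x
  have hxt : x ∈ Set.range t := ht₀ ⟨Classical.arbitrary T, rfl⟩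
  obtain ⟨t', ht'⟩ := Cardinal.exists_range_eq (T := T) (S := (Y ∪ Set.range t) \ Y)
    ⟨x, Or.inr hxt, hx⟩ <| (Cardinal.mk_le_mk_of_subset (by
      rintro y ⟨hy | hy, hyY⟩
      exacts [absurd hy hyY, hy])).trans Cardinal.mk_range_le
  obtain ⟨hproj, hrange⟩ := projective_ker_and_comap_range he hY hZ Set.subset_union_left ht'
  set D := (Finsupp.supported V V Y).map σ with hD
  have hker : LinearMap.ker (D.mkQ ∘ₗ g) = D.comap g := by
    rw [LinearMap.ker_comp, Submodule.ker_mkQ]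
  obtain ⟨h', hle, hdom'⟩ := exists_linearPMap_le_domain_eq_comap_range (D.mkQ ∘ₗ g)
    (D.mkQ_surjective.comp hg) (by
      rw [hker]
      intro r b hb
      obtain ⟨c, hc, hcb⟩ := hY.exists_smul_eq r (g b) (by simpa [hD] using hb)
      obtain ⟨b', rfl⟩ := hg c
      obtain ⟨a, ha, hab⟩ := hpure r (b - b') (by simp [smul_sub, hcb])
      refine ⟨a + b', ?_, by rw [smul_add, hab, smul_sub, sub_add_cancel]⟩
      rw [Submodule.mem_comap, map_add, LinearMap.mem_ker.1 ha, zero_add]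
      exact hc) (D.mkQ ∘ₗ σ ∘ₗ Finsupp.lmapDomain V V t') (hN _ hproj) h (hdom.trans hker.symm)
  refine ⟨_, h', Set.subset_union_left, Or.inr hxt, hle, hZ, ?_⟩
  rw [hdom', Submodule.comap_comp, hrange]

lemma exists_retraction_of_presentation {V : Type u} [CommRing V] {X T : Type w} [Infinite T]
    {N B C : Type*} [AddCommGroup N] [Module V N] [AddCommGroup B] [Module V B]
    [AddCommGroup C] [Module V C] {σ : (X →₀ V) →ₗ[V] C}
    (e : LinearMap.ker σ →ₗ[V] (LinearMap.ker σ →₀ V)) (hσ : Function.Surjective σ)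
    (he : ∀ k, Finsupp.linearCombination V Subtype.val (e k) = k.1)
    (enum : T → V × (T →₀ V)) (henum : Function.Surjective enum)
    (hN : ∀ L : Submodule V (T →₀ V), Module.Projective V L →
      ∀ f : LinearMap.ker (PureCover.proj V ((T →₀ V) ⧸ L)) →ₗ[V] N,
        ∃ g : PureCover V ((T →₀ V) ⧸ L) →ₗ[V] N, g ∘ₗ Submodule.subtype _ = f)
    (f : N →ₗ[V] B) (hf : Function.Injective f) (g : B →ₗ[V] C) (hg : Function.Surjective g)
    (hfg : LinearMap.range f = LinearMap.ker g)
    (hpure : ∀ (r : V) (b : B), r • b ∈ LinearMap.ker g → ∃ a ∈ LinearMap.ker g, r • a = r • b) :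
    ∃ h : B →ₗ[V] N, h ∘ₗ f = LinearMap.id := by
  let s : Set (Set X × (B →ₗ.[V] N)) := {y | IsAdaptedSet σ e y.1 ∧
    y.2.domain = ((Finsupp.supported V V y.1).map σ).comap g}
  let h₀ : B →ₗ.[V] N := ⟨LinearMap.range f, (LinearEquiv.ofInjective f hf).symm.toLinearMap⟩
  have hs₀ : (∅, h₀) ∈ s := ⟨IsAdaptedSet.empty, by
    simpa [h₀] using hfg⟩
  obtain ⟨⟨Y, h⟩, hle, hmax⟩ := zorn_le_nonempty₀ s (fun c hcs hc y hy => by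
    have hc₁ : DirectedOn (· ≤ ·) (Prod.fst '' c) :=
      (Monotone.isChain_image monotone_fst hc).directedOn
    have hc₂ : DirectedOn (· ≤ ·) (Prod.snd '' c) :=
      (Monotone.isChain_image monotone_snd hc).directedOn
    refine ⟨(⋃₀ (Prod.fst '' c), LinearPMap.sSup _ hc₂), ⟨?_, ?_⟩, fun z hz =>
      ⟨Set.subset_sUnion_of_mem ⟨z, hz, rfl⟩, LinearPMap.le_sSup hc₂ ⟨z, hz, rfl⟩⟩⟩
    · refine IsAdaptedSet.sUnion ⟨_, y, hy, rfl⟩ hc₁ ?_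
      rintro _ ⟨z, hz, rfl⟩
      exact (hcs hz).1
    · ext b
      rw [LinearPMap.mem_domain_sSup_iff (Set.Nonempty.image _ ⟨y, hy⟩), Submodule.mem_comap]
      constructor
      · rintro ⟨_, ⟨z, hz, rfl⟩, hb⟩
        rw [(hcs hz).2] at hb
        exact Submodule.map_mono
          (Finsupp.supported_mono (Set.subset_sUnion_of_mem (Set.mem_image_of_mem _ hz))) hb
      · rintro ⟨v, hv, hvb⟩
        obtain ⟨_, ⟨z, hz, rfl⟩, hvz⟩ :=
          IsAdaptedSet.exists_mem_supported_of_directedOn (Set.Nonempty.image _ ⟨y, hy⟩) hc₁ hv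
        refine ⟨_, ⟨z, hz, rfl⟩, ?_⟩
        rw [(hcs hz).2]
        exact ⟨v, hvz, hvb⟩) _ hs₀
  obtain ⟨hY, hdom⟩ := hmax.1
  have hYu : Y = Set.univ := by
    by_contra hne
    obtain ⟨x, hx⟩ := (Set.ne_univ_iff_exists_notMem Y).1 hne
    obtain ⟨Z, h', hYZ, hxZ, hle', hZ, hdom'⟩ :=
      hY.exists_linearPMap_lt hσ he enum henum hN hg hpure h hdom hx
    exact hx ((hmax.2 (y := (Z, h')) ⟨hZ, hdom'⟩ ⟨hYZ, hle'⟩).1 hxZ)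
  have htop (b : B) : b ∈ h.domain := by
    obtain ⟨v, hv⟩ := hσ (g b)
    rw [show h.domain = _ from hdom, hYu, Finsupp.supported_univ]
    exact ⟨v, Submodule.mem_top, hv⟩
  refine ⟨h.toFun ∘ₗ LinearMap.id.codRestrict h.domain htop, ?_⟩
  ext n
  have : h₀ ⟨f n, n, rfl⟩ = h ⟨f n, htop _⟩ := (show h₀ ≤ h from hle.2).2 rfl
  exact this.symm.trans ((LinearEquiv.ofInjective f hf).symm_apply_apply n)

/-- Extension of maps along pure embeddings holds for the `r`-torsion of an injective module. -/
lemma exists_extension_torsionBy {V : Type u} [CommRing V] {A P E : Type w} [AddCommGroup A]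
    [Module V A] [AddCommGroup P] [Module V P] [AddCommGroup E] [Module V E]
    [Module.Injective V E] (i : A →ₗ[V] P) (r : V)
    (hpure : ∀ a p, i a = r • p → ∃ a', a = r • a') (f : A →ₗ[V] Submodule.torsionBy V E r) :
    ∃ g : P →ₗ[V] Submodule.torsionBy V E r, g ∘ₗ i = f := by
  let S := LinearMap.range (LinearMap.lsmul V P r)
  let S' := LinearMap.range (LinearMap.lsmul V A r)
  have hS' : S' ≤ LinearMap.ker ((Submodule.torsionBy V E r).subtype ∘ₗ f) := by
    rintro _ ⟨a, rfl⟩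
    simp
  let ι : A ⧸ S' →ₗ[V] P ⧸ S := S'.liftQ (S.mkQ ∘ₗ i) (by
    rintro _ ⟨a, rfl⟩
    exact (Submodule.Quotient.mk_eq_zero S).2 ⟨i a, by simp⟩)
  have hι : Function.Injective ι := by
    rw [injective_iff_map_eq_zero]
    intro x hx
    obtain ⟨a, rfl⟩ := S'.mkQ_surjective x
    obtain ⟨p, hp⟩ := (Submodule.Quotient.mk_eq_zero S).1 hx
    obtain ⟨a', rfl⟩ := hpure a p hp.symm
    exact (Submodule.Quotient.mk_eq_zero S').2 ⟨a', rfl⟩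
  obtain ⟨g, hg⟩ := Module.Injective.out ι hι (S'.liftQ _ hS')
  refine ⟨(g ∘ₗ S.mkQ).codRestrict _ fun p => ?_, ?_⟩
  · rw [Submodule.mem_torsionBy_iff, ← map_smul, LinearMap.comp_apply]
    have : S.mkQ (r • p) = 0 := (Submodule.Quotient.mk_eq_zero S).2 ⟨p, rfl⟩
    rw [this, map_zero]
  · ext a
    exact hg (S'.mkQ a)

lemma isPureSub_range_iff {V : Type u} [CommRing V] {A : Type w} {B : Type v} [AddCommGroup A]
    [Module V A] [AddCommGroup B] [Module V B] {f : A →ₗ[V] B} :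
    IsPureSub V (LinearMap.range f) ↔ ∀ (r : V) a b, f a = r • b → ∃ a', f a = r • f a' := by
  refine ⟨fun h r a b hab => ?_, fun h r => le_antisymm ?_ ?_⟩
  · have : f a ∈ r • LinearMap.range f := by
      rw [h r]
      exact ⟨⟨a, rfl⟩, Submodule.mem_smul_pointwise_iff_exists .. |>.2 ⟨b, trivial, hab.symm⟩⟩
    obtain ⟨_, ⟨a', rfl⟩, ha'⟩ := Submodule.mem_smul_pointwise_iff_exists .. |>.1 this
    exact ⟨a', ha'.symm⟩
  · intro x hx
    obtain ⟨_, ⟨a, rfl⟩, rfl⟩ := Submodule.mem_smul_pointwise_iff_exists .. |>.1 hx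
    exact ⟨⟨r • a, map_smul f r a⟩,
      Submodule.mem_smul_pointwise_iff_exists .. |>.2 ⟨f a, trivial, rfl⟩⟩
  · rintro _ ⟨⟨a, rfl⟩, hb⟩
    obtain ⟨b, -, hb⟩ := Submodule.mem_smul_pointwise_iff_exists .. |>.1 hb
    obtain ⟨a', ha'⟩ := h r a b hb.symm
    exact Submodule.mem_smul_pointwise_iff_exists .. |>.2 ⟨f a', ⟨a', rfl⟩, ha'.symm⟩

lemma PdLeOne.projective_ker {V : Type u} [CommRing V] {C : Type v} [AddCommGroup C] [Module V C]
    (hC : PdLeOne V C) {P : Type*} [AddCommGroup P] [Module V P] [Module.Projective V P]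
    (σ : P →ₗ[V] C) (hσ : Function.Surjective σ) : Module.Projective V (LinearMap.ker σ) := by
  obtain ⟨P', _, _, σ', _, hσ', _⟩ := hC
  obtain ⟨a, ha⟩ := Module.projective_lifting_property σ σ' hσ
  obtain ⟨b, hb⟩ := Module.projective_lifting_property σ' σ hσ'
  exact projective_ker_of_comp_eq σ' σ a b ha hb

lemma linearCombination_id_surjective (V C : Type*) [CommRing V] [AddCommGroup C] [Module V C] :
    Function.Surjective (Finsupp.linearCombination V (id : C → C)) := fun c =>
  ⟨Finsupp.single c 1, by simp⟩

lemma pdLeOne_of_projective_ker {V : Type u} [CommRing V] {C : Type v} [AddCommGroup C]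
    [Module V C]
    (h : Module.Projective V (LinearMap.ker (Finsupp.linearCombination V (id : C → C)))) :
    PdLeOne V C :=
  ⟨C →₀ V, inferInstance, inferInstance, _, inferInstance, linearCombination_id_surjective V C, h⟩

lemma Submodule.exists_linearCombination_section {V F : Type*} [CommRing V] [AddCommGroup F]
    [Module V F] (K : Submodule V F) [Module.Projective V K] :
    ∃ e : K →ₗ[V] (K →₀ V), ∀ k, Finsupp.linearCombination V Subtype.val (e k) = k.1 := by
  obtain ⟨e, he⟩ := Module.projective_def'.1 (inferInstance : Module.Projective V K)
  refine ⟨e, fun k => ?_⟩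
  have h : Finsupp.linearCombination V id (e k) = k := congr($he k)
  conv_rhs => rw [← h]
  exact (Finsupp.apply_linearCombination V K.subtype id (e k)).symm

lemma exists_surjective_prod_finsupp (V : Type u) [CommRing V] [Nontrivial V] :
    ∃ enum : ULift.{v} V × ℕ → V × (ULift.{v} V × ℕ →₀ V), Function.Surjective enum := by
  have hV : Cardinal.mk (ULift.{v} V) ≤ Cardinal.mk (ULift.{v} V × ℕ) :=
    Cardinal.mk_le_of_injective (f := fun x => (x, 0)) fun x y h => congrArg Prod.fst h
  have h : Cardinal.mk (ULift.{v} V × (ULift.{v} V × ℕ →₀ V)) ≤ Cardinal.mk (ULift.{v} V × ℕ) := by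
    rw [← Cardinal.mul_def, Cardinal.mk_finsupp_lift_of_infinite,
      Cardinal.lift_id'.{u, v} (Cardinal.mk (ULift.{v} V × ℕ)), Cardinal.lift_umax.{u, v},
      ← Cardinal.mk_uLift.{u, v}, max_eq_left hV]
    exact (mul_le_mul' hV le_rfl).trans (Cardinal.mul_eq_self (Cardinal.aleph0_le_mk _)).le
  obtain ⟨f⟩ := h
  exact ⟨Prod.map ULift.down id ∘ Function.invFun f,
    (ULift.down_surjective.prodMap Function.surjective_id).comp
      (Function.invFun_surjective f.injective)⟩

lemma pdLeOne_uLift {V : Type u} [CommRing V] {M : Type v} [AddCommGroup M] [Module V M]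
    (hM : PdLeOne V M) : PdLeOne V (ULift.{u} M) := by
  let eM : ULift.{u} M ≃ₗ[V] M := ULift.moduleEquiv
  have := hM.projective_ker (eM.toLinearMap ∘ₗ Finsupp.linearCombination V id)
    (eM.surjective.comp (linearCombination_id_surjective V _))
  rw [LinearEquiv.ker_comp] at this
  exact pdLeOne_of_projective_ker this

lemma PdLeOne.hasInjectiveKernelLifting {V : Type u} [CommRing V] {A B C : Type (max u v)}
    [AddCommGroup A] [Module V A] [AddCommGroup B] [Module V B] [AddCommGroup C] [Module V C]
    (hC : PdLeOne V C) {i : A →ₗ[V] B} (hi : Function.Injective i) {g : B →ₗ[V] C}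
    (hig : LinearMap.range i = LinearMap.ker g) (hg : Function.Surjective g) :
    HasInjectiveKernelLifting V i := by
  intro X Y E _ _ _ _ _ _ _ p hp q hq f t hft
  obtain ⟨P, _, _, σ, _, hσ, _⟩ := hC
  exact exists_lift_of_projective_ker i g hi hig hg σ hσ p hp q hq f t hft

lemma HasInjectiveKernelLifting.pdLeOne {V : Type u} [CommRing V] {A B C : Type (max u v)}
    [AddCommGroup A] [Module V A] [AddCommGroup B] [Module V B] [AddCommGroup C] [Module V C]
    {i : A →ₗ[V] B} (h : HasInjectiveKernelLifting V i) {g : B →ₗ[V] C}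
    (hig : LinearMap.range i = LinearMap.ker g) (hg : Function.Surjective g) : PdLeOne V C :=
  pdLeOne_of_projective_ker
    (projective_ker_of_lift i g hig hg _ (linearCombination_id_surjective V C) h)

lemma hasInjectiveKernelLifting_zero_iff {V : Type u} [CommRing V] {B : Type (max u v)}
    [AddCommGroup B] [Module V B] :
    HasInjectiveKernelLifting V (0 : PUnit.{max u v + 1} →ₗ[V] B) ↔ PdLeOne V B :=
  ⟨fun h => h.pdLeOne (g := LinearMap.id)
    (by rw [LinearMap.range_zero, LinearMap.ker_id]) Function.surjective_id, fun h =>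
    h.hasInjectiveKernelLifting (g := LinearMap.id) (Function.injective_of_subsingleton _)
      (by rw [LinearMap.range_zero, LinearMap.ker_id]) Function.surjective_id⟩

lemma HasInjectiveKernelLifting.comp_zero {V : Type u} [CommRing V] {A B : Type w}
    [AddCommGroup A] [Module V A] [AddCommGroup B] [Module V B] {i : A →ₗ[V] B}
    (hi : HasInjectiveKernelLifting V i)
    (hA : HasInjectiveKernelLifting V (0 : PUnit.{w + 1} →ₗ[V] A)) :
    HasInjectiveKernelLifting V (0 : PUnit.{w + 1} →ₗ[V] B) := by
  intro X Y E _ _ _ _ _ _ _ p hp q hq f t hft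
  obtain ⟨h, -, hph⟩ := hA X Y E p hp q hq 0 (t ∘ₗ i) (by simp)
  obtain ⟨h', -, hph'⟩ := hi X Y E p hp q hq h t hph
  exact ⟨h', Subsingleton.elim _ _, hph'⟩

/-- Every module of projective dimension at most one is a pure and tight submodule of such a
module which is injective relative to a given family of pure and tight submodules. -/
lemma exists_pure_tight_extension {V : Type u} [CommRing V] {ι : Type (max u v)}
    {P Q : ι → Type (max u v)} [∀ k, AddCommGroup (P k)] [∀ k, Module V (P k)]
    [∀ k, AddCommGroup (Q k)] [∀ k, Module V (Q k)] (π : ∀ k, P k →ₗ[V] Q k)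
    (hπ : ∀ k, Function.Surjective (π k)) (hQ : ∀ k, PdLeOne V (Q k))
    (hπpure : ∀ k (r : V) p, r • p ∈ LinearMap.ker (π k) →
      ∃ p' ∈ LinearMap.ker (π k), r • p' = r • p)
    {M : Type v} [AddCommGroup M] [Module V M] (hM : PdLeOne V M) :
    ∃ (N : Type (max u v)) (_ : AddCommGroup N) (_ : Module V N) (j : M →ₗ[V] N),
      Function.Injective j ∧ PdLeOne V N ∧
      IsPureSub V (LinearMap.range j) ∧
      PdLeOne V (N ⧸ LinearMap.range j) ∧
      ∀ k (f : LinearMap.ker (π k) →ₗ[V] N), ∃ g : P k →ₗ[V] N, g ∘ₗ Submodule.subtype _ = f := by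
  have hK (k) : HasInjectiveKernelLifting V (LinearMap.ker (π k)).subtype :=
    PdLeOne.hasInjectiveKernelLifting.{u, v} (hQ k) (Submodule.subtype_injective _)
      (Submodule.range_subtype _) (hπ k)
  obtain ⟨N, _, _, j, hN, hj⟩ := exists_relative_cell_extension.{u, v}
    (fun k => (LinearMap.ker (π k)).subtype) (ULift.{u} M)
  have hjlift : HasInjectiveKernelLifting V j := by
    intro X Y E _ _ _ _ _ _ _ p hp q hq
    exact hj X Y p fun k => hK k X Y E p hp q hq
  let eM : M ≃ₗ[V] ULift.{u} M := ULift.moduleEquiv.symm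
  have hrange : LinearMap.range (j ∘ₗ eM.toLinearMap) = LinearMap.range j :=
    LinearEquiv.range_comp eM j
  have hpure (r : V) (m : ULift.{u} M) (n : N) (hmn : j m = r • n) : ∃ m', m = r • m' := by
    let S := LinearMap.range (LinearMap.lsmul V (ULift.{u} M) r)
    obtain ⟨E, _, _, ι, _, hι⟩ := exists_injective_embedding.{u, max u v} (V := V) (ULift.{u} M ⧸ S)
    let f : ULift.{u} M →ₗ[V] Submodule.torsionBy V E r :=
      (ι ∘ₗ S.mkQ).codRestrict _ fun m => by
        rw [Submodule.mem_torsionBy_iff, ← map_smul, LinearMap.comp_apply]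
        have : S.mkQ (r • m) = 0 := (Submodule.Quotient.mk_eq_zero S).2 ⟨m, rfl⟩
        rw [this, map_zero]
    obtain ⟨g, hg, -⟩ := hj _ PUnit.{max u v + 1}
      (0 : Submodule.torsionBy V E r →ₗ[V] PUnit.{max u v + 1})
      (fun k f' _ _ => by
        obtain ⟨g, hg⟩ := exists_extension_torsionBy (LinearMap.ker (π k)).subtype r
          (fun a p hap => by
            obtain ⟨p', hp', h⟩ := hπpure k r p (hap ▸ a.2)
            exact ⟨⟨p', hp'⟩, Subtype.ext (hap.trans h.symm)⟩) f'
        exact ⟨g, hg, Subsingleton.elim _ _⟩) f 0 (Subsingleton.elim _ _)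
    have hfm : f m = 0 := by
      have h₁ : g (j m) = f m := congr($hg m)
      rw [← h₁, hmn, map_smul]
      exact Subtype.ext (g n).2
    have hm : S.mkQ m = 0 := hι ((congrArg Subtype.val hfm).trans (map_zero ι).symm)
    obtain ⟨m', hm'⟩ := (Submodule.Quotient.mk_eq_zero S).1 hm
    exact ⟨m', hm'.symm⟩
  refine ⟨N, inferInstance, inferInstance, j ∘ₗ eM.toLinearMap, ?_, ?_, ?_, ?_, hN⟩
  · have hinj : Function.Injective j := by
      rw [injective_iff_map_eq_zero]
      intro m hm
      obtain ⟨m', rfl⟩ := hpure 0 m 0 (by simpa using hm)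
      exact zero_smul V m'
    exact hinj.comp eM.injective
  · exact hasInjectiveKernelLifting_zero_iff.{u, v}.1
      (hjlift.comp_zero (hasInjectiveKernelLifting_zero_iff.{u, v}.2 (pdLeOne_uLift hM)))
  · rw [hrange, isPureSub_range_iff]
    intro r m n hmn
    obtain ⟨m', rfl⟩ := hpure r m n hmn
    exact ⟨m', map_smul j r m'⟩
  · rw [hrange]
    exact HasInjectiveKernelLifting.pdLeOne.{u, v} hjlift (Submodule.ker_mkQ _).symm
      (Submodule.mkQ_surjective _)

lemma exists_pure_tight_pureCover_extension {V : Type u} [CommRing V] (F : Type (max u v))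
    [AddCommGroup F] [Module V F] [Module.Projective V F] {M : Type v} [AddCommGroup M]
    [Module V M] (hM : PdLeOne V M) :
    ∃ (N : Type (max u v)) (_ : AddCommGroup N) (_ : Module V N) (j : M →ₗ[V] N),
      Function.Injective j ∧ PdLeOne V N ∧
      IsPureSub V (LinearMap.range j) ∧
      PdLeOne V (N ⧸ LinearMap.range j) ∧
      ∀ L : Submodule V F, Module.Projective V L →
        ∀ f : LinearMap.ker (PureCover.proj V (F ⧸ L)) →ₗ[V] N,
          ∃ g : PureCover V (F ⧸ L) →ₗ[V] N, g ∘ₗ Submodule.subtype _ = f := by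
  obtain ⟨N, i₁, i₂, j, hj, hN, hpure, htight, hext⟩ := exists_pure_tight_extension.{u, v}
    (fun L : {L : Submodule V F // Module.Projective V L} => PureCover.proj V (F ⧸ L.1))
    (fun _ => PureCover.proj_surjective)
    (fun L => ⟨F, inferInstance, inferInstance, L.1.mkQ, inferInstance, L.1.mkQ_surjective, by
      rw [Submodule.ker_mkQ]; exact L.2⟩)
    (fun _ _ _ => PureCover.exists_smul_eq_of_smul_mem_ker_proj) hM
  exact ⟨N, i₁, i₂, j, hj, hN, hpure, htight, fun L hL => hext ⟨L, hL⟩⟩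

/-- every module of p.d. ≤ 1 is a pure and tight submodule of a
pure-injective object of p.d. ≤ 1. -/
theorem statement18 (V : Type u) [CommRing V] [IsDomain V] [ValuationRing V]
    (M : Type v) [AddCommGroup M] [Module V M] (hM : PdLeOne V M) :
    ∃ (N : Type (max u v)) (_ : AddCommGroup N) (_ : Module V N) (j : M →ₗ[V] N),
      Function.Injective j ∧ PdLeOne V N ∧
      IsPureSub V (LinearMap.range j) ∧
      PdLeOne V (N ⧸ LinearMap.range j) ∧
      (∀ (C : Type (max u v)) [AddCommGroup C] [Module V C], PdLeOne V C →
        ∀ (N' : Type (max u v)) [AddCommGroup N'] [Module V N']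
          (f : N →ₗ[V] N') (g : N' →ₗ[V] C),
          Function.Injective f → Function.Surjective g →
          LinearMap.range f = LinearMap.ker g →
          IsPureSub V (LinearMap.range f) →
          ∃ h : N' →ₗ[V] N, h ∘ₗ f = LinearMap.id) := by
  obtain ⟨enum, henum⟩ := exists_surjective_prod_finsupp.{u, v} V
  obtain ⟨N, _, _, j, hj, hN, hpure, htight, hext⟩ :=
    exists_pure_tight_pureCover_extension.{u, v} (ULift.{v} V × ℕ →₀ V) hM
  refine ⟨N, inferInstance, inferInstance, j, hj, hN, hpure, htight, ?_⟩
  intro C _ _ hC N' _ _ f g hf hg hfg hfpure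
  have := hC.projective_ker _ (linearCombination_id_surjective V C)
  obtain ⟨e, he⟩ := Submodule.exists_linearCombination_section
    (F := C →₀ V) (LinearMap.ker (Finsupp.linearCombination V (id : C → C)))
  refine exists_retraction_of_presentation e (linearCombination_id_surjective V C) he enum henum
    hext f hf g hg hfg fun r b hb => ?_
  rw [← hfg] at hb ⊢
  obtain ⟨n, hn⟩ := hb
  obtain ⟨n', hn'⟩ := isPureSub_range_iff.1 hfpure r n b hn
  exact ⟨f n', ⟨n', rfl⟩, hn'.symm.trans hn⟩
end

section
/- Let V be a valuation domain and M a V-module with pd M ≤ 1 that is a pure-injective object, i.e., every short exact sequence 0 → M → N → C → 0 of V-modules in which the image of M is pure in N and pd C ≤ 1 splits. Then the first Ulm submodule M¹ = ⋂_{r ∈ V, r ≠ 0} rM is a divisible V-module, and consequently Ext¹_V(C, M¹) = 0 for every V-module C with pd C ≤ 1. -/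
universe u v

open Pointwise

/-- `D` is a divisible module. -/
def Divisible (V : Type u) [CommRing V] (D : Type*) [AddCommGroup D]
    [Module V D] : Prop :=
  ∀ r : V, r ≠ 0 → ∀ d : D, ∃ e : D, r • e = d

/-- The injectivity property of `M` with respect to pure extensions by modules of projective
dimension at most one. -/
def PureInjectiveObject (V : Type u) [CommRing V] (M : Type v) [AddCommGroup M] [Module V M] :
    Prop :=
  ∀ (C : Type (max u v)) [AddCommGroup C] [Module V C], PdLeOne V C →
    ∀ (N : Type (max u v)) [AddCommGroup N] [Module V N]
      (f : M →ₗ[V] N) (g : N →ₗ[V] C),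
      Function.Injective f → Function.Surjective g →
      LinearMap.range f = LinearMap.ker g →
      IsPureSub V (LinearMap.range f) →
      ∃ h : N →ₗ[V] M, h ∘ₗ f = LinearMap.id

section Ulm

variable {V : Type u} [CommRing V] {M : Type v} [AddCommGroup M] [Module V M]

variable (V M) in
/-- The first Ulm submodule. -/
abbrev ulmSubmodule : Submodule V M := ⨅ (r : V) (_ : r ≠ 0), r • (⊤ : Submodule V M)

theorem mem_ulmSubmodule {x : M} :
    x ∈ ulmSubmodule V M ↔ ∀ r : V, r ≠ 0 → ∃ y : M, r • y = x := by
  simp [ulmSubmodule, Submodule.mem_iInf, Submodule.mem_smul_pointwise_iff_exists]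

theorem pdLeOne_quotient_range {K P : Type (max u v)} [AddCommGroup K] [Module V K]
    [AddCommGroup P] [Module V P] [Module.Projective V K] [Module.Projective V P]
    (i : K →ₗ[V] P) (hi : Function.Injective i) : PdLeOne V (P ⧸ LinearMap.range i) := by
  refine ⟨P, inferInstance, inferInstance, (LinearMap.range i).mkQ, inferInstance,
    Submodule.mkQ_surjective _, ?_⟩
  rw [Submodule.ker_mkQ]
  exact Module.Projective.of_equiv (LinearEquiv.ofInjective i hi)

/-- Pushing out a projective presentation along a map with values in the first Ulm submodule
gives a pure extension, so the map extends. -/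
theorem PureInjectiveObject.exists_extension (hM : PureInjectiveObject V M)
    {K P : Type (max u v)} [AddCommGroup K] [Module V K] [AddCommGroup P] [Module V P]
    [Module.Projective V K] [Module.Projective V P]
    (i : K →ₗ[V] P) (hi : Function.Injective i)
    (φ : K →ₗ[V] M) (hφ : ∀ k, φ k ∈ ulmSubmodule V M) :
    ∃ ψ : P →ₗ[V] M, ∀ k, ψ (i k) = φ k := by
  let R : Submodule V (M × P) := LinearMap.range (φ.prod (-i))
  have mem_R (m : M) (p : P) : (m, p) ∈ R ↔ ∃ k, φ k = m ∧ -i k = p := by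
    simp [R, LinearMap.mem_range, Prod.ext_iff]
  let f : M →ₗ[V] (M × P) ⧸ R := R.mkQ ∘ₗ LinearMap.inl V M P
  have hR : R ≤ LinearMap.ker ((LinearMap.range i).mkQ ∘ₗ LinearMap.snd V M P) := by
    rintro ⟨m, p⟩ h
    obtain ⟨k, -, rfl⟩ := (mem_R m p).1 h
    simp
  let g : (M × P) ⧸ R →ₗ[V] P ⧸ LinearMap.range i := R.liftQ _ hR
  have hf : Function.Injective f := by
    rw [injective_iff_map_eq_zero]
    intro m hm
    obtain ⟨k, rfl, hk⟩ := (mem_R m 0).1 ((Submodule.Quotient.mk_eq_zero R).1 hm)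
    rw [neg_eq_zero, map_eq_zero_iff i hi] at hk
    simp [hk]
  have hg : Function.Surjective g := by
    intro c
    obtain ⟨p, rfl⟩ := Submodule.mkQ_surjective _ c
    exact ⟨R.mkQ (0, p), rfl⟩
  have hfg : LinearMap.range f = LinearMap.ker g := by
    apply le_antisymm
    · rintro _ ⟨m, rfl⟩
      simp [f, g]
    · intro n hn
      obtain ⟨⟨m, p⟩, rfl⟩ := Submodule.mkQ_surjective _ n
      obtain ⟨k, rfl⟩ : ∃ k, i k = p :=
        (Submodule.Quotient.mk_eq_zero (LinearMap.range i)).1 hn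
      refine ⟨m + φ k, (Submodule.Quotient.eq R).2 ?_⟩
      exact (mem_R _ _).2 ⟨k, by simp, by simp⟩
  have hpure : IsPureSub V (LinearMap.range f) := by
    intro t
    apply le_antisymm
    · exact le_inf (Submodule.smul_le_self_of_tower t _)
        (smul_mono_right t le_top)
    · rintro _ ⟨⟨m, rfl⟩, hm⟩
      obtain ⟨n, -, hn⟩ := (Submodule.mem_smul_pointwise_iff_exists _ _ _).1 hm
      obtain ⟨⟨m', p⟩, rfl⟩ := Submodule.mkQ_surjective _ n
      obtain ⟨k, hk, -⟩ := (mem_R _ _).1 ((Submodule.Quotient.eq R).1 hn)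
      by_cases ht : t = 0
      · simp [← hn, ht]
      · obtain ⟨y, hy⟩ := mem_ulmSubmodule.1 (hφ k) t ht
        refine (Submodule.mem_smul_pointwise_iff_exists _ _ _).2 ⟨f (m' - y), ⟨_, rfl⟩, ?_⟩
        rw [← map_smul, smul_sub, hy, hk]
        congr 1
        simp
  obtain ⟨h, hh⟩ := hM _ (pdLeOne_quotient_range i hi) _ f g hf hg hfg hpure
  refine ⟨h ∘ₗ R.mkQ ∘ₗ LinearMap.inr V M P, fun k => ?_⟩
  rw [← LinearMap.id_apply (R := V) (φ k), ← hh]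
  refine congrArg h ((Submodule.Quotient.eq R).2 ((mem_R _ _).2 ⟨-k, ?_, ?_⟩)) <;> simp

theorem Finsupp.linearCombination_single_apply {ι : Type*} (c : ι → V) (a : ι →₀ V) (j : ι) :
    Finsupp.linearCombination V (fun i => Finsupp.single i (c i)) a j = a j * c j := by
  induction a using Finsupp.induction_linear with
  | zero => simp
  | add a b ha hb => simp [ha, hb, add_mul]
  | single i x =>
    by_cases h : i = j
    · subst h; simp
    · simp [h]

/-- A map with values in the first Ulm submodule extends within the first Ulm submodule: adjoin
to `P` an `s`-th part of each of its elements, for each `s ≠ 0`, before extending. -/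
theorem PureInjectiveObject.exists_extension_ulmSubmodule [IsDomain V]
    (hM : PureInjectiveObject V M)
    {K P : Type (max u v)} [AddCommGroup K] [Module V K] [AddCommGroup P] [Module V P]
    [Module.Projective V K] [Module.Projective V P]
    (i : K →ₗ[V] P) (hi : Function.Injective i) (φ : K →ₗ[V] ulmSubmodule V M) :
    ∃ ψ : P →ₗ[V] ulmSubmodule V M, ∀ k, ψ (i k) = φ k := by
  let I := P × {s : V // s ≠ 0}
  let scale : (I →₀ V) →ₗ[V] (I →₀ V) :=
    Finsupp.linearCombination V fun x => Finsupp.single x x.2.1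
  let base : (I →₀ V) →ₗ[V] P := Finsupp.linearCombination V Prod.fst
  let j : K × (I →₀ V) →ₗ[V] P × (I →₀ V) :=
    (i.coprod (-base)).prod (scale ∘ₗ LinearMap.snd V _ _)
  have hj : Function.Injective j := by
    rw [injective_iff_map_eq_zero]
    rintro ⟨k, a⟩ h
    have h₂ : scale a = 0 := congrArg Prod.snd h
    have ha : a = 0 := by
      ext x
      have := DFunLike.congr_fun h₂ x
      rw [Finsupp.linearCombination_single_apply] at this
      exact (mul_eq_zero.1 this).resolve_right x.2.2
    have h₁ : i k + -base a = 0 := congrArg Prod.fst h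
    rw [ha, map_zero, neg_zero, add_zero, map_eq_zero_iff i hi] at h₁
    rw [ha, h₁, Prod.mk_zero_zero]
  obtain ⟨ψ, hψ⟩ := hM.exists_extension j hj
    ((ulmSubmodule V M).subtype ∘ₗ φ ∘ₗ LinearMap.fst V _ _) fun x => (φ x.1).2
  have mem (p : P) : ψ (p, 0) ∈ ulmSubmodule V M := by
    refine mem_ulmSubmodule.2 fun s hs => ⟨ψ (0, Finsupp.single (p, ⟨s, hs⟩) 1), ?_⟩
    have h := hψ (0, Finsupp.single (p, ⟨s, hs⟩) 1)
    have e : j (0, Finsupp.single (p, ⟨s, hs⟩) 1) =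
        s • (0, Finsupp.single (p, ⟨s, hs⟩) 1) - (p, 0) := by
      simp [j, base, scale]
    rw [e, map_sub, map_smul] at h
    simpa [sub_eq_zero] using h
  refine ⟨(ψ ∘ₗ LinearMap.inl V _ _).codRestrict _ mem, fun k => Subtype.ext ?_⟩
  change ψ (i k, 0) = φ k
  simpa [j] using hψ (k, 0)

theorem PureInjectiveObject.divisible_ulmSubmodule [IsDomain V]
    (hM : PureInjectiveObject V M) : Divisible V (ulmSubmodule V M) := by
  intro r hr d
  have hP : Module.Projective V (ULift.{v} V) :=
    Module.Projective.of_equiv ULift.moduleEquiv.symm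
  obtain ⟨ψ, hψ⟩ := hM.exists_extension_ulmSubmodule
    (LinearMap.lsmul V (ULift.{v} V) r)
    (fun x y h => ULift.ext _ _ (mul_left_cancel₀ hr (congrArg ULift.down h)))
    (LinearMap.toSpanSingleton V _ d ∘ₗ ULift.moduleEquiv.toLinearMap)
  refine ⟨ψ ⟨1⟩, ?_⟩
  rw [← map_smul]
  simpa using hψ ⟨1⟩

end Ulm

/-- An extension of `C` by `D` splits if maps to `D` extend along a projective presentation
of `C`. -/
theorem exists_retraction_of_exists_extension {V P C N D : Type*} [CommRing V]
    [AddCommGroup P] [Module V P] [AddCommGroup C] [Module V C] [AddCommGroup N] [Module V N]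
    [AddCommGroup D] [Module V D] [Module.Projective V P]
    (q : P →ₗ[V] C) (hq : Function.Surjective q)
    (hD : ∀ φ : LinearMap.ker q →ₗ[V] D, ∃ ψ : P →ₗ[V] D, ∀ k : LinearMap.ker q, ψ k = φ k)
    (f : D →ₗ[V] N) (g : N →ₗ[V] C) (hf : Function.Injective f) (hg : Function.Surjective g)
    (hfg : LinearMap.range f = LinearMap.ker g) :
    ∃ h : N →ₗ[V] D, h ∘ₗ f = LinearMap.id := by
  obtain ⟨l, hl⟩ := Module.projective_lifting_property g q hg
  have hl' (p : P) : g (l p) = q p := LinearMap.congr_fun hl p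
  have hk (k : LinearMap.ker q) : l k ∈ LinearMap.range f := by
    rw [hfg, LinearMap.mem_ker, hl', k.2]
  let φ : LinearMap.ker q →ₗ[V] D :=
    (LinearEquiv.ofInjective f hf).symm.toLinearMap ∘ₗ
      (l ∘ₗ (LinearMap.ker q).subtype).codRestrict (LinearMap.range f) hk
  have hφ (k : LinearMap.ker q) : f (φ k) = l k :=
    congrArg Subtype.val ((LinearEquiv.ofInjective f hf).apply_symm_apply ⟨l k, hk k⟩)
  obtain ⟨ψ, hψ⟩ := hD φ
  have hs : Function.Surjective (f.coprod l) := by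
    intro n
    obtain ⟨p, hp⟩ := hq (g n)
    obtain ⟨d, hd⟩ : n - l p ∈ LinearMap.range f := by
      rw [hfg, LinearMap.mem_ker, map_sub, hl', hp, sub_self]
    exact ⟨(d, p), by simp [hd]⟩
  have hker : LinearMap.ker (f.coprod l) ≤ LinearMap.ker (LinearMap.id.coprod ψ) := by
    rintro ⟨d, p⟩ h
    have h0 : f d + l p = 0 := h
    have hgf : g (f d) = 0 := LinearMap.mem_ker.1 (hfg ▸ LinearMap.mem_range_self f d)
    have hp : q p = 0 := by
      simpa [hgf, hl'] using congrArg g h0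
    have hψp : ψ p = φ ⟨p, hp⟩ := hψ ⟨p, hp⟩
    change d + ψ p = 0
    apply hf
    rw [map_add, hψp, hφ, h0, map_zero]
  refine ⟨(LinearMap.ker (f.coprod l)).liftQ _ hker ∘ₗ
    ((f.coprod l).quotKerEquivOfSurjective hs).symm.toLinearMap, LinearMap.ext fun d => ?_⟩
  have e : ((f.coprod l).quotKerEquivOfSurjective hs).symm (f d) =
      (LinearMap.ker (f.coprod l)).mkQ (d, 0) := by
    rw [LinearEquiv.symm_apply_eq]
    simp
  simp only [LinearMap.comp_apply, LinearEquiv.coe_coe, e]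
  simp

/-- the first Ulm submodule of a pure-injective object is divisible,
hence Ext¹(C, M¹) = 0 (every short exact sequence 0 → M¹ → N → C → 0 with
p.d. C ≤ 1 splits). -/
theorem statement19 (V : Type u) [CommRing V] [IsDomain V] [ValuationRing V]
    (M : Type v) [AddCommGroup M] [Module V M] (hM : PdLeOne V M)
    (hpi : ∀ (C : Type (max u v)) [AddCommGroup C] [Module V C], PdLeOne V C →
      ∀ (N : Type (max u v)) [AddCommGroup N] [Module V N]
        (f : M →ₗ[V] N) (g : N →ₗ[V] C),
        Function.Injective f → Function.Surjective g →
        LinearMap.range f = LinearMap.ker g →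
        IsPureSub V (LinearMap.range f) →
        ∃ h : N →ₗ[V] M, h ∘ₗ f = LinearMap.id) :
    Divisible V ↥(⨅ (r : V) (_ : r ≠ 0), r • (⊤ : Submodule V M)) ∧
    (∀ (C : Type (max u v)) [AddCommGroup C] [Module V C], PdLeOne V C →
      ∀ (N : Type (max u v)) [AddCommGroup N] [Module V N]
        (f : ↥(⨅ (r : V) (_ : r ≠ 0), r • (⊤ : Submodule V M)) →ₗ[V] N)
        (g : N →ₗ[V] C),
        Function.Injective f → Function.Surjective g →
        LinearMap.range f = LinearMap.ker g →
        ∃ h : N →ₗ[V] ↥(⨅ (r : V) (_ : r ≠ 0), r • (⊤ : Submodule V M)),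
          h ∘ₗ f = LinearMap.id) := by
  have hM' : PureInjectiveObject V M := hpi
  refine ⟨hM'.divisible_ulmSubmodule, ?_⟩
  rintro C _ _ ⟨P, _, _, q, _, hq, _⟩ N _ _ f g hf hg hfg
  exact exists_retraction_of_exists_extension q hq
    (fun φ => hM'.exists_extension_ulmSubmodule (LinearMap.ker q).subtype
      Subtype.val_injective φ) f g hf hg hfg
end
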